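/- Let S be a set of N points in the plane in general position with N even, let T be a triangulation of S, and let M be a perfect matching of S all of whose edges belong to T. Then there exists a set F of ps-flippable edges of T with |F| ≥ N/2 − 3 such that no edge of F belongs to M. -/

import Mathlib

open scoped Classical

noncomputable section

/-- Points of the plane. -/
abbrev Pt : Type := ℝ × ℝ

/-- A finite point set is in general position if no three of its points are collinear. -/
def GenPos (S : Finset Pt) : Prop :=
  ∀ p ∈ S, ∀ q ∈ S, ∀ r ∈ S, p ≠ q → p ≠ r → q ≠ r →
    ¬ Collinear ℝ ({p, q, r} : Set Pt)

/-- The closed straight segment spanned by an unordered pair of points. -/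
def seg2 (e : Sym2 Pt) : Set Pt :=
  Sym2.lift ⟨fun p q => segment ℝ p q, fun p q => segment_symm ℝ p q⟩ e

/-- A crossing-free straight-edge graph (plane graph) on the point set `S`:
its edges are straight segments between points of `S`, any two of which
meet only at shared endpoints. -/
structure PlaneGraph (S : Finset Pt) where
  edges : Finset (Sym2 Pt)
  endpoint_mem : ∀ e ∈ edges, ∀ p, p ∈ e → p ∈ S
  not_isDiag : ∀ e ∈ edges, ¬ e.IsDiag
  noncrossing : ∀ e₁ ∈ edges, ∀ e₂ ∈ edges, e₁ ≠ e₂ →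
    ∀ x ∈ seg2 e₁ ∩ seg2 e₂, x ∈ e₁ ∧ x ∈ e₂

/-- A triangulation of `S` is a maximal plane graph on `S`. -/
def IsTriangulation {S : Finset Pt} (T : PlaneGraph S) : Prop :=
  ∀ G : PlaneGraph S, T.edges ⊆ G.edges → G.edges = T.edges

/-- `tr S`: the number of triangulations of `S`. -/
def triCount (S : Finset Pt) : ℕ :=
  Nat.card {T : PlaneGraph S // IsTriangulation T}

/-- A plane graph is a spanning cycle of `S` if its edges form a Hamiltonian
cycle on `S`. -/
def IsSpanningCycle {S : Finset Pt} (G : PlaneGraph S) : Prop :=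
  3 ≤ S.card ∧ ∃ f : Fin S.card ≃ {p : Pt // p ∈ S},
    G.edges =
      Finset.image (fun i : Fin S.card => s(((f i : Pt)), ((f (finRotate S.card i) : Pt)))) Finset.univ

/-- `sc S`: the number of crossing-free straight-edge spanning cycles of `S`. -/
def scCount (S : Finset Pt) : ℕ :=
  Nat.card {G : PlaneGraph S // IsSpanningCycle G}

/-- A plane graph is a perfect matching of `S` if every point of `S` is incident
to exactly one edge. -/
def IsPerfectMatching {S : Finset Pt} (G : PlaneGraph S) : Prop :=
  ∀ p ∈ S, ∃! e, e ∈ G.edges ∧ p ∈ e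

/-- `pm S`: the number of crossing-free straight-edge perfect matchings of `S`. -/
def pmCount (S : Finset Pt) : ℕ :=
  Nat.card {G : PlaneGraph S // IsPerfectMatching G}

/-- The support of a plane graph `G` on `S`: the number of triangulations of `S`
containing all edges of `G`. -/
def supp {S : Finset Pt} (G : PlaneGraph S) : ℕ :=
  Nat.card {T : PlaneGraph S // IsTriangulation T ∧ G.edges ⊆ T.edges}

/-- A finite set of points is in (strictly) convex position. -/
def InConvexPosition (Q : Finset Pt) : Prop :=
  ∀ p ∈ Q, p ∉ convexHull ℝ (↑(Q.erase p) : Set Pt)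

/-- `p q` is an edge of the convex hull boundary of `Q`. -/
def IsHullEdgeOf (Q : Finset Pt) (p q : Pt) : Prop :=
  p ∈ Q ∧ q ∈ Q ∧ p ≠ q ∧
    segment ℝ p q ⊆ frontier (convexHull ℝ (Q : Set Pt))

/-- `e` is a diagonal of the convex polygon with vertex set `Q`. -/
def IsDiagonalOf (Q : Finset Pt) (e : Sym2 Pt) : Prop :=
  ∃ p ∈ Q, ∃ q ∈ Q, e = s(p, q) ∧
    openSegment ℝ p q ⊆ interior (convexHull ℝ (Q : Set Pt))

/-- `F` is a set of ps-flippable (pseudo-simultaneously flippable) edges of the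
triangulation `T`: the edges of `F` are diagonals of pairwise interior-disjoint
(empty) convex polygons whose boundary edges all belong to `T`. -/
def IsPsFlippable {S : Finset Pt} (T : PlaneGraph S) (F : Finset (Sym2 Pt)) : Prop :=
  F ⊆ T.edges ∧
  ∃ 𝒬 : Finset (Finset Pt),
    (∀ Q ∈ 𝒬, ↑Q ⊆ (S : Set Pt) ∧ 3 ≤ Q.card ∧ InConvexPosition Q ∧
      (∀ p q, IsHullEdgeOf Q p q → s(p, q) ∈ T.edges) ∧
      (∀ p ∈ S, p ∉ interior (convexHull ℝ (Q : Set Pt)))) ∧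
    (∀ Q ∈ 𝒬, ∀ Q' ∈ 𝒬, Q ≠ Q' →
      interior (convexHull ℝ (Q : Set Pt)) ∩ interior (convexHull ℝ (Q' : Set Pt)) = ∅) ∧
    (∀ e ∈ F, ∃ Q ∈ 𝒬, IsDiagonalOf Q e)

/-- The drawing of a plane graph: the union of its (closed) edge segments and
its vertex set. -/
def drawing {S : Finset Pt} (G : PlaneGraph S) : Set Pt :=
  (⋃ e ∈ G.edges, seg2 e) ∪ (S : Set Pt)

/-- A convex decomposition of `S`: a plane graph containing all convex hull
boundary edges, whose bounded faces are all convex, and with no isolated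
vertices. -/
def IsConvexDecomposition {S : Finset Pt} (D : PlaneGraph S) : Prop :=
  (∀ p q, IsHullEdgeOf S p q → s(p, q) ∈ D.edges) ∧
  (∀ x ∉ drawing D, Bornology.IsBounded (connectedComponentIn (drawing D)ᶜ x) →
    Convex ℝ (connectedComponentIn (drawing D)ᶜ x)) ∧
  (∀ p ∈ S, ∃ e ∈ D.edges, p ∈ e)

/-- `p` is an interior vertex of `S` (not on the convex hull boundary). -/
def InteriorVtx (S : Finset Pt) (p : Pt) : Prop :=
  p ∈ S ∧ p ∉ frontier (convexHull ℝ (S : Set Pt))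

/-- `p` has a valid triple of edges in `G`. -/
def IsValidAt {S : Finset Pt} (G : PlaneGraph S) (p : Pt) : Prop :=
  ∃ a ∈ S, ∃ b ∈ S, ∃ c ∈ S,
    p ∈ convexHull ℝ ({a, b, c} : Set Pt) ∧
    s(p, a) ∈ G.edges ∧ s(p, b) ∈ G.edges ∧ s(p, c) ∈ G.edges

/-- The degree of a point in a plane graph. -/
def degree {S : Finset Pt} (G : PlaneGraph S) (p : Pt) : ℕ :=
  (G.edges.filter (fun e => p ∈ e)).card

/-- `a b c` span a triangular face of the triangulation `T`. -/
def IsTriFace {S : Finset Pt} (T : PlaneGraph S) (a b c : Pt) : Prop :=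
  a ∈ S ∧ b ∈ S ∧ c ∈ S ∧
  s(a, b) ∈ T.edges ∧ s(b, c) ∈ T.edges ∧ s(a, c) ∈ T.edges ∧
  ∀ p ∈ S, p ∉ interior (convexHull ℝ ({a, b, c} : Set Pt))

/-- An edge of a triangulation is flippable if its two incident triangles form
a convex quadrilateral. -/
def IsFlippable {S : Finset Pt} (T : PlaneGraph S) (e : Sym2 Pt) : Prop :=
  e ∈ T.edges ∧ ∃ a b c d : Pt, e = s(a, b) ∧ c ≠ d ∧
    IsTriFace T a b c ∧ IsTriFace T a b d ∧
    (openSegment ℝ a b ∩ openSegment ℝ c d).Nonempty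

/-- `flip T`: the number of flippable edges of `T`. -/
def flipCount {S : Finset Pt} (T : PlaneGraph S) : ℕ :=
  (T.edges.filter (fun e => IsFlippable T e)).card

/-- `v3 T`: the number of interior vertices of degree 3 in `T`. -/
def v3 {S : Finset Pt} (T : PlaneGraph S) : ℕ :=
  (S.filter (fun p => p ∉ frontier (convexHull ℝ (S : Set Pt)) ∧ degree T p = 3)).card

/-- The number of vertices of `S` on its convex hull boundary. -/
def hullVtxCount (S : Finset Pt) : ℕ :=
  (S.filter (fun p => p ∈ frontier (convexHull ℝ (S : Set Pt)))).card

def dt (p q r : Pt) : ℝ := (q.1-p.1)*(r.2-p.2) - (q.2-p.2)*(r.1-p.1)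

lemma dt_swap (p q r : Pt) : dt q p r = - dt p q r := by unfold dt; ring
lemma dt_swap' (p q r : Pt) : dt p r q = - dt p q r := by unfold dt; ring
lemma dt_rot (p q r : Pt) : dt q r p = dt p q r := by unfold dt; ring
lemma dt_self1 (p q : Pt) : dt p q p = 0 := by unfold dt; ring
lemma dt_self2 (p q : Pt) : dt p q q = 0 := by unfold dt; ring
lemma dt_self3 (p q : Pt) : dt p p q = 0 := by unfold dt; ring

lemma mem_seg {p q z : Pt} : z ∈ segment ℝ p q ↔
    ∃ t : ℝ, 0 ≤ t ∧ t ≤ 1 ∧ z.1 = (1-t)*p.1 + t*q.1 ∧ z.2 = (1-t)*p.2 + t*q.2 := by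
  constructor
  · rintro ⟨a, b, ha, hb, hab, rfl⟩
    have ha' : a = 1 - b := by linarith
    refine ⟨b, hb, by linarith, ?_, ?_⟩ <;> simp [ha']
  · rintro ⟨t, h0, h1, hx, hy⟩
    exact ⟨1-t, t, by linarith, h0, by ring, Prod.ext (by simp [hx]) (by simp [hy])⟩

lemma mem_oseg {p q z : Pt} : z ∈ openSegment ℝ p q ↔
    ∃ t : ℝ, 0 < t ∧ t < 1 ∧ z.1 = (1-t)*p.1 + t*q.1 ∧ z.2 = (1-t)*p.2 + t*q.2 := by
  constructor
  · rintro ⟨a, b, ha, hb, hab, rfl⟩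
    have ha' : a = 1 - b := by linarith
    refine ⟨b, hb, by linarith, ?_, ?_⟩ <;> simp [ha']
  · rintro ⟨t, h0, h1, hx, hy⟩
    exact ⟨1-t, t, by linarith, h0, by ring, Prod.ext (by simp [hx]) (by simp [hy])⟩

lemma dt_comb (p q u v z : Pt) (t : ℝ) (h1 : z.1 = (1-t)*u.1 + t*v.1)
    (h2 : z.2 = (1-t)*u.2 + t*v.2) : dt p q z = (1-t) * dt p q u + t * dt p q v := by
  unfold dt; rw [h1, h2]; ring

lemma line_param {p q z : Pt} (hpq : p ≠ q) (h : dt p q z = 0) :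
    ∃ t : ℝ, z.1 = (1-t)*p.1 + t*q.1 ∧ z.2 = (1-t)*p.2 + t*q.2 := by
  unfold dt at h
  by_cases h1 : q.1 - p.1 = 0
  · have h2 : q.2 - p.2 ≠ 0 := fun h2 => hpq (Prod.ext (by linarith) (by linarith))
    refine ⟨(z.2-p.2)/(q.2-p.2), ?_, ?_⟩
    · have : z.1 - p.1 = 0 := by
        rw [h1] at h
        have : (q.2-p.2)*(z.1-p.1) = 0 := by linarith
        exact (mul_eq_zero.1 this).resolve_left h2
      have e : q.1 = p.1 := by linarith
      rw [e]; linarith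
    · field_simp; ring
  · refine ⟨(z.1-p.1)/(q.1-p.1), ?_, ?_⟩
    · field_simp; ring
    · field_simp; linarith

lemma gp_dt {S : Finset Pt} (hS : GenPos S) {p q r : Pt} (hp : p ∈ S) (hq : q ∈ S) (hr : r ∈ S)
    (hpq : p ≠ q) (hpr : p ≠ r) (hqr : q ≠ r) : dt p q r ≠ 0 := by
  intro h
  obtain ⟨t, h1, h2⟩ := line_param hpq h
  apply hS p hp q hq r hr hpq hpr hqr
  rw [collinear_iff_of_mem (p₀ := p) (by simp)]
  refine ⟨q - p, ?_⟩
  intro x hx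
  simp only [Set.mem_insert_iff, Set.mem_singleton_iff] at hx
  rcases hx with rfl | rfl | rfl
  · exact ⟨0, by simp⟩
  · exact ⟨1, by simp⟩
  · exact ⟨t, Prod.ext (by simp [h1]; ring) (by simp [h2]; ring)⟩

lemma gp_zero {S : Finset Pt} (hS : GenPos S) {p q r : Pt} (hp : p ∈ S) (hq : q ∈ S) (hr : r ∈ S)
    (hpq : p ≠ q) (h : dt p q r = 0) : r = p ∨ r = q := by
  by_contra hc
  push Not at hc
  exact gp_dt hS hp hq hr hpq (Ne.symm hc.1) (Ne.symm hc.2) h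

lemma aff_convex (A B C : ℝ) : Convex ℝ {z : Pt | 0 ≤ A*z.1+B*z.2+C} := by
  intro x hx y hy a b ha hb hab
  simp only [Set.mem_ofPred_eq, Prod.fst_add, Prod.smul_fst, Prod.snd_add, Prod.smul_snd, smul_eq_mul] at *
  have : A*(a*x.1+b*y.1)+B*(a*x.2+b*y.2)+C = a*(A*x.1+B*x.2+C)+b*(A*y.1+B*y.2+C) := by
    linear_combination (-C)*hab
  rw [this]; positivity

lemma aff_convex' (A B C : ℝ) : Convex ℝ {z : Pt | 0 < A*z.1+B*z.2+C} := by
  intro x hx y hy a b ha hb hab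
  simp only [Set.mem_ofPred_eq, Prod.fst_add, Prod.smul_fst, Prod.snd_add, Prod.smul_snd, smul_eq_mul] at *
  have : A*(a*x.1+b*y.1)+B*(a*x.2+b*y.2)+C = a*(A*x.1+B*x.2+C)+b*(A*y.1+B*y.2+C) := by
    linear_combination (-C)*hab
  rw [this]
  rcases ha.eq_or_lt with rfl | ha'
  · have : b = 1 := by linarith
    subst this; linarith
  · have := mul_pos ha' hx
    have := mul_nonneg hb hy.le
    linarith

lemma hull_aff {Q : Set Pt} (A B C : ℝ) (h : ∀ r ∈ Q, 0 ≤ A*r.1+B*r.2+C) :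
    ∀ z ∈ convexHull ℝ Q, 0 ≤ A*z.1+B*z.2+C :=
  fun _ hz => convexHull_min (t := {z : Pt | 0 ≤ A*z.1+B*z.2+C}) h (aff_convex A B C) hz

lemma hull_aff' {Q : Set Pt} (A B C : ℝ) (h : ∀ r ∈ Q, 0 < A*r.1+B*r.2+C) :
    ∀ z ∈ convexHull ℝ Q, 0 < A*z.1+B*z.2+C :=
  fun _ hz => convexHull_min (t := {z : Pt | 0 < A*z.1+B*z.2+C}) h (aff_convex' A B C) hz

lemma dt_form (p q z : Pt) :
    dt p q z = (-(q.2-p.2))*z.1 + (q.1-p.1)*z.2 + ((q.2-p.2)*p.1-(q.1-p.1)*p.2) := by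
  unfold dt; ring

lemma hull_dt {Q : Set Pt} {p q : Pt} (h : ∀ r ∈ Q, 0 ≤ dt p q r) :
    ∀ z ∈ convexHull ℝ Q, 0 ≤ dt p q z := by
  intro z hz
  rw [dt_form]
  exact hull_aff _ _ _ (fun r hr => by rw [← dt_form]; exact h r hr) z hz

lemma dt_cont (p q : Pt) : Continuous (fun z => dt p q z) := by
  unfold dt; fun_prop

lemma comb3_mem {s : Set Pt} (hs : Convex ℝ s) {a b c z : Pt} (ha : a ∈ s) (hb : b ∈ s) (hc : c ∈ s)
    (x y w : ℝ) (hx : 0 ≤ x) (hy : 0 ≤ y) (hw : 0 ≤ w) (h : x + y + w = 1)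
    (h1 : z.1 = x*a.1+y*b.1+w*c.1) (h2 : z.2 = x*a.2+y*b.2+w*c.2) : z ∈ s := by
  have := hs.sum_mem (t := Finset.univ) (w := ![x,y,w]) (z := ![a,b,c])
    (by intro i _; fin_cases i <;> simpa) (by simp [Fin.sum_univ_three, h])
    (by intro i _; fin_cases i <;> simpa)
  convert this
  apply Prod.ext <;> simp [Fin.sum_univ_three, h1, h2]

lemma tri_mem' {s : Set Pt} (hs : Convex ℝ s) {a b c z : Pt} (ha : a ∈ s) (hb : b ∈ s) (hc : c ∈ s)
    (h : 0 < dt a b c) (h1 : 0 ≤ dt a b z)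
    (h2 : 0 ≤ dt b c z) (h3 : 0 ≤ dt c a z) : z ∈ s := by
  refine comb3_mem hs ha hb hc (dt b c z / dt a b c) (dt c a z / dt a b c) (dt a b z / dt a b c)
    (by positivity) (by positivity) (by positivity) ?_ ?_ ?_
  · field_simp; unfold dt; ring
  · field_simp; unfold dt; ring
  · field_simp; unfold dt; ring

lemma tri_mem {a b c z : Pt} (h : 0 < dt a b c) (h1 : 0 ≤ dt a b z)
    (h2 : 0 ≤ dt b c z) (h3 : 0 ≤ dt c a z) : z ∈ convexHull ℝ ({a, b, c} : Set Pt) :=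
  tri_mem' (convex_convexHull ℝ _) (subset_convexHull ℝ _ (by simp)) (subset_convexHull ℝ _ (by simp))
    (subset_convexHull ℝ _ (by simp)) h h1 h2 h3

lemma tri_dt {a b c z : Pt} (h : 0 < dt a b c) (hz : z ∈ convexHull ℝ ({a, b, c} : Set Pt)) :
    0 ≤ dt a b z ∧ 0 ≤ dt b c z ∧ 0 ≤ dt c a z := by
  have e1 := dt_rot a b c
  have e2 := dt_rot b c a
  refine ⟨hull_dt ?_ z hz, hull_dt ?_ z hz, hull_dt ?_ z hz⟩ <;>
  · intro r hr
    simp only [Set.mem_insert_iff, Set.mem_singleton_iff] at hr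
    rcases hr with rfl | rfl | rfl <;> first | (simp only [dt_self1, dt_self2, le_refl]; done) | linarith

/-- Strict inequalities put a point in the interior. -/
lemma tri_int {s : Set Pt} (hs : Convex ℝ s) {a b c z : Pt} (ha : a ∈ s) (hb : b ∈ s) (hc : c ∈ s)
    (h : 0 < dt a b c) (h1 : 0 < dt a b z)
    (h2 : 0 < dt b c z) (h3 : 0 < dt c a z) : z ∈ interior s := by
  rw [mem_interior]
  refine ⟨{z | 0 < dt a b z} ∩ {z | 0 < dt b c z} ∩ {z | 0 < dt c a z}, ?_, ?_, ⟨⟨h1, h2⟩, h3⟩⟩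
  · rintro w ⟨⟨k1, k2⟩, k3⟩
    exact tri_mem' hs ha hb hc h (le_of_lt k1) (le_of_lt k2) (le_of_lt k3)
  · exact ((isOpen_lt continuous_const (dt_cont a b)).inter (isOpen_lt continuous_const (dt_cont b c))).inter
      (isOpen_lt continuous_const (dt_cont c a))

/-- If a nonconstant affine function is nonnegative on s, interior points have positive value. -/
lemma aff_int {s : Set Pt} (A B C : ℝ) (hAB : A ≠ 0 ∨ B ≠ 0) (h : ∀ r ∈ s, 0 ≤ A*r.1+B*r.2+C)
    {z : Pt} (hz : z ∈ interior s) : 0 < A*z.1+B*z.2+C := by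
  by_contra hc
  push Not at hc
  have hpos : 0 < A^2+B^2 := by rcases hAB with h | h <;> positivity
  have hcont : Continuous (fun t : ℝ => ((z.1 - t*A, z.2 - t*B) : Pt)) := by fun_prop
  have h0 : (fun t : ℝ => ((z.1 - t*A, z.2 - t*B) : Pt)) 0 ∈ interior s := by simpa using hz
  have := hcont.continuousAt.preimage_mem_nhds (isOpen_interior.mem_nhds h0)
  obtain ⟨ε, he, hball⟩ := Metric.mem_nhds_iff.1 this
  have hm : (ε/2) ∈ Metric.ball (0:ℝ) ε := by
    rw [Metric.mem_ball, Real.dist_eq, sub_zero, abs_of_pos (by linarith)]; linarith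
  have := h _ (interior_subset (hball hm))
  simp only at this
  nlinarith

lemma dt_int {s : Set Pt} {p q : Pt} (hpq : p ≠ q) (h : ∀ r ∈ s, 0 ≤ dt p q r)
    {z : Pt} (hz : z ∈ interior s) : 0 < dt p q z := by
  rw [dt_form]
  refine aff_int _ _ _ ?_ (fun r hr => by rw [← dt_form]; exact h r hr) hz
  by_contra hc
  push Not at hc
  exact hpq (Prod.ext (by linarith) (by linarith))

/-- separation of a vertex -/
lemma sep {Q : Finset Pt} {p : Pt} (h : p ∉ convexHull ℝ (Q : Set Pt)) :
    ∃ A B : ℝ, ∀ r ∈ Q, 0 < A*(r.1-p.1)+B*(r.2-p.2) := by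
  obtain ⟨f, u, h1, h2⟩ := geometric_hahn_banach_point_closed (convex_convexHull ℝ _)
    (Set.Finite.isClosed_convexHull ℝ Q.finite_toSet) h
  refine ⟨f (1,0), f (0,1), fun r hr => ?_⟩
  have h3 := h2 r (subset_convexHull ℝ _ hr)
  have key : ∀ z : Pt, f z = f (1,0) * z.1 + f (0,1) * z.2 := by
    intro z
    have : z = z.1 • ((1,0):Pt) + z.2 • ((0,1):Pt) := by apply Prod.ext <;> simp
    conv_lhs => rw [this]
    rw [map_add, map_smul, map_smul]; simp; ring
  rw [key] at h1 h3
  linarith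

lemma not_hull_of_pos {Q : Set Pt} {p : Pt} (A B : ℝ) (h : ∀ r ∈ Q, 0 < A*(r.1-p.1)+B*(r.2-p.2)) :
    p ∉ convexHull ℝ Q := by
  intro hp
  have := hull_aff' (Q := Q) A B (-(A*p.1+B*p.2)) (fun r hr => by have := h r hr; linarith) p hp
  linarith

/-- vertices of convex position sets are not interior -/
lemma vert_not_int {Q : Finset Pt} (h : InConvexPosition Q) (hc : 2 ≤ Q.card) {p : Pt} (hp : p ∈ Q) :
    p ∉ interior (convexHull ℝ (Q : Set Pt)) := by
  intro hi
  obtain ⟨A, B, hAB⟩ := sep (h p hp)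
  obtain ⟨r, hr, hne⟩ := Finset.exists_mem_ne (s := Q) (by omega) p
  have hr' := hAB r (Finset.mem_erase.2 ⟨hne, hr⟩)
  have := aff_int (s := convexHull ℝ (Q : Set Pt)) A B (-(A*p.1+B*p.2)) ?_ (hull_aff _ _ _ ?_) hi
  · linarith
  · by_contra hc
    push Not at hc
    rw [hc.1, hc.2] at hr'; simp at hr'
  · intro x hx
    by_cases hxp : x = p
    · subst hxp; linarith
    · have := hAB x (Finset.mem_erase.2 ⟨hxp, hx⟩); linarith

/-- angularly extreme vector among those in an open half plane -/
lemma ang_max {X : Finset Pt} (hX : X.Nonempty) {p : Pt} (A B : ℝ)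
    (h : ∀ r ∈ X, 0 < A*(r.1-p.1)+B*(r.2-p.2)) : ∃ a ∈ X, ∀ r ∈ X, 0 ≤ dt p r a := by
  obtain ⟨a, ha, hmax⟩ := Finset.exists_max_image X
    (fun r => (-B*(r.1-p.1)+A*(r.2-p.2)) / (A*(r.1-p.1)+B*(r.2-p.2))) hX
  refine ⟨a, ha, fun r hr => ?_⟩
  have h1 := hmax r hr
  have ha' := h a ha
  have hr' := h r hr
  rw [div_le_div_iff₀ hr' ha'] at h1
  have hpos : 0 < A^2+B^2 := by
    by_contra hc
    have hA : A = 0 := by nlinarith [sq_nonneg A, sq_nonneg B]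
    have hB : B = 0 := by nlinarith [sq_nonneg A, sq_nonneg B]
    rw [hA, hB] at ha'; simp at ha'
  have : 0 ≤ (A^2+B^2) * dt p r a := by unfold dt; nlinarith
  exact (mul_nonneg_iff_of_pos_left hpos).1 this

lemma ang_min {X : Finset Pt} (hX : X.Nonempty) {p : Pt} (A B : ℝ)
    (h : ∀ r ∈ X, 0 < A*(r.1-p.1)+B*(r.2-p.2)) : ∃ a ∈ X, ∀ r ∈ X, 0 ≤ dt p a r := by
  obtain ⟨a, ha, hmax⟩ := Finset.exists_min_image X
    (fun r => (-B*(r.1-p.1)+A*(r.2-p.2)) / (A*(r.1-p.1)+B*(r.2-p.2))) hX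
  refine ⟨a, ha, fun r hr => ?_⟩
  have h1 := hmax r hr
  have ha' := h a ha
  have hr' := h r hr
  rw [div_le_div_iff₀ ha' hr'] at h1
  have hpos : 0 < A^2+B^2 := by
    by_contra hc
    have hA : A = 0 := by nlinarith [sq_nonneg A, sq_nonneg B]
    have hB : B = 0 := by nlinarith [sq_nonneg A, sq_nonneg B]
    rw [hA, hB] at ha'; simp at ha'
  have : 0 ≤ (A^2+B^2) * dt p a r := by unfold dt; nlinarith
  exact (mul_nonneg_iff_of_pos_left hpos).1 this

/-- point on line with bounds lies on the segment -/
lemma seg_of_line {p q w : Pt} (hpq : p ≠ q) (h : dt p q w = 0) (A B A' B' : ℝ)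
    (hp : 0 < A*(q.1-p.1)+B*(q.2-p.2)) (hq : 0 < A'*(p.1-q.1)+B'*(p.2-q.2))
    (hp' : 0 ≤ A*(w.1-p.1)+B*(w.2-p.2)) (hq' : 0 ≤ A'*(w.1-q.1)+B'*(w.2-q.2)) :
    w ∈ segment ℝ p q := by
  obtain ⟨t, h1, h2⟩ := line_param hpq h
  refine mem_seg.2 ⟨t, ?_, ?_, h1, h2⟩
  · have : 0 ≤ t * (A*(q.1-p.1)+B*(q.2-p.2)) := by rw [h1, h2] at hp'; linarith
    exact nonneg_of_mul_nonneg_left this hp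
  · have : 0 ≤ (1-t) * (A'*(p.1-q.1)+B'*(p.2-q.2)) := by rw [h1, h2] at hq'; linarith
    have := nonneg_of_mul_nonneg_left this hq
    linarith

/-- crossing point of a segment with a line -/
lemma cross_line {p q x y : Pt} (hx : 0 ≤ dt p q x) (hy : dt p q y < 0) :
    ∃ w ∈ segment ℝ x y, dt p q w = 0 := by
  have hd : 0 < dt p q x - dt p q y := by linarith
  refine ⟨(((1-dt p q x / (dt p q x - dt p q y)))*x.1 + (dt p q x / (dt p q x - dt p q y))*y.1,
    ((1-dt p q x / (dt p q x - dt p q y)))*x.2 + (dt p q x / (dt p q x - dt p q y))*y.2),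
    mem_seg.2 ⟨dt p q x / (dt p q x - dt p q y), by positivity, ?_, rfl, rfl⟩, ?_⟩
  · rw [div_le_one hd]; linarith
  · rw [dt_comb p q x y _ (dt p q x / (dt p q x - dt p q y)) rfl rfl]
    field_simp; ring

lemma seg2_mk (p q : Pt) : seg2 s(p,q) = segment ℝ p q := rfl

lemma pl (p a b c d : Pt) : dt p a b * dt p c d - dt p a c * dt p b d + dt p a d * dt p b c = 0 := by
  unfold dt; ring

lemma plσ (σ : ℝ) (p a b c d : Pt) : (σ * dt p a b) * (σ * dt p c d) - (σ * dt p a c) * (σ * dt p b d)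
    + (σ * dt p a d) * (σ * dt p b c) = 0 := by
  unfold dt; ring

lemma ang_sig {σ : ℝ} (hσ : σ ≠ 0) {X : Finset Pt} (hX : X.Nonempty) {p : Pt} (A B : ℝ)
    (h : ∀ r ∈ X, 0 < A*(r.1-p.1)+B*(r.2-p.2)) : ∃ a ∈ X, ∀ r ∈ X, 0 ≤ σ * dt p a r := by
  rcases lt_or_gt_of_ne hσ with h1 | h1
  · obtain ⟨a, ha, hh⟩ := ang_max hX A B h
    refine ⟨a, ha, fun r hr => ?_⟩
    have := hh r hr
    rw [dt_swap'] at this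
    nlinarith
  · obtain ⟨a, ha, hh⟩ := ang_min hX A B h
    exact ⟨a, ha, fun r hr => mul_nonneg h1.le (hh r hr)⟩

lemma onedge {S : Finset Pt} (hS : GenPos S) (T : PlaneGraph S) {e : Sym2 Pt} (he : e ∈ T.edges)
    {x : Pt} (hx : x ∈ S) (hxe : x ∈ seg2 e) : x ∈ e := by
  induction e using Sym2.ind with
  | _ u v =>
  have hu := T.endpoint_mem _ he u (by simp)
  have hv := T.endpoint_mem _ he v (by simp)
  have huv : u ≠ v := fun h => T.not_isDiag _ he (by simpa using h)
  rw [seg2_mk] at hxe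
  obtain ⟨t, _, _, h1, h2⟩ := mem_seg.1 hxe
  have h0 : dt u v x = 0 := by rw [dt_comb u v u v x t h1 h2, dt_self1, dt_self2]; ring
  rcases gp_zero hS hu hv hx huv h0 with h | h <;> simp [h]

lemma oseg_dt {p q z : Pt} (h : z ∈ segment ℝ p q) : dt p q z = 0 := by
  obtain ⟨t, _, _, h1, h2⟩ := mem_seg.1 h
  rw [dt_comb p q p q z t h1 h2, dt_self1, dt_self2]; ring

lemma oseg_ne {p q z : Pt} (hpq : p ≠ q) (h : z ∈ openSegment ℝ p q) : z ≠ p ∧ z ≠ q := by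
  obtain ⟨t, h0, h1, hx, hy⟩ := mem_oseg.1 h
  constructor
  · rintro rfl
    apply hpq
    have a : t * (q.1 - z.1) = 0 := by linarith
    have b : t * (q.2 - z.2) = 0 := by linarith
    have a' := (mul_eq_zero.1 a).resolve_left h0.ne'
    have b' := (mul_eq_zero.1 b).resolve_left h0.ne'
    exact Prod.ext (by linarith) (by linarith)
  · rintro rfl
    apply hpq
    have h1' : (1 - t) ≠ 0 := by linarith
    have a : (1-t) * (p.1 - z.1) = 0 := by linarith
    have b : (1-t) * (p.2 - z.2) = 0 := by linarith
    have a' := (mul_eq_zero.1 a).resolve_left h1'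
    have b' := (mul_eq_zero.1 b).resolve_left h1'
    exact Prod.ext (by linarith) (by linarith)

lemma oseg_notS {S : Finset Pt} (hS : GenPos S) {p q z : Pt} (hp : p ∈ S) (hq : q ∈ S) (hpq : p ≠ q)
    (h : z ∈ openSegment ℝ p q) : z ∉ S := by
  intro hz
  have := gp_zero hS hp hq hz hpq (oseg_dt (openSegment_subset_segment ℝ _ _ h))
  have h2 := oseg_ne hpq h
  tauto

lemma seg_cases {p q z : Pt} (h : z ∈ segment ℝ p q) : z = p ∨ z = q ∨ z ∈ openSegment ℝ p q := by
  rw [← insert_endpoints_openSegment] at h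
  simpa using h

lemma maxi {S : Finset Pt} (hS : GenPos S) {T : PlaneGraph S} (hT : IsTriangulation T) {p s : Pt}
    (hp : p ∈ S) (hs : s ∈ S) (hne : p ≠ s)
    (h : ∀ e ∈ T.edges, e ≠ s(p,s) → ∀ y ∈ openSegment ℝ p s, y ∉ seg2 e) : s(p,s) ∈ T.edges := by
  have key : ∀ e ∈ T.edges, e ≠ s(p,s) → ∀ x, x ∈ segment ℝ p s → x ∈ seg2 e → x ∈ e ∧ x ∈ s(p,s) := by
    intro e he hee x hx hxe
    rcases seg_cases hx with rfl | rfl | hx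
    · exact ⟨onedge hS T he hp hxe, by simp⟩
    · exact ⟨onedge hS T he hs hxe, by simp⟩
    · exact absurd hxe (h e he hee x hx)
  let G : PlaneGraph S :=
    { edges := insert s(p,s) T.edges
      endpoint_mem := by
        intro e he x hx
        rcases Finset.mem_insert.1 he with rfl | he
        · rcases Sym2.mem_iff.1 hx with rfl | rfl <;> assumption
        · exact T.endpoint_mem e he x hx
      not_isDiag := by
        intro e he
        rcases Finset.mem_insert.1 he with rfl | he
        · simpa using hne
        · exact T.not_isDiag e he
      noncrossing := by
        intro e₁ h₁ e₂ h₂ h12 x hx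
        rcases Finset.mem_insert.1 h₁ with rfl | h₁
        · rcases Finset.mem_insert.1 h₂ with rfl | h₂
          · exact absurd rfl h12
          · exact (key e₂ h₂ (Ne.symm h12) x hx.1 hx.2).symm
        · rcases Finset.mem_insert.1 h₂ with rfl | h₂
          · exact key e₁ h₁ h12 x hx.2 hx.1
          · exact T.noncrossing e₁ h₁ e₂ h₂ h12 x hx }
  have : G.edges = T.edges := hT G (Finset.subset_insert _ _)
  rw [← this]
  exact Finset.mem_insert_self _ _

lemma ivt2 {f0 f1 g0 g1 : ℝ} (hf : 0 < f0) (hg : 0 < g0) (h : f1 ≤ 0 ∨ g1 ≤ 0) :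
    ∃ t : ℝ, 0 < t ∧ t ≤ 1 ∧ (((1-t)*f0+t*f1 = 0 ∧ 0 ≤ (1-t)*g0+t*g1) ∨
      ((1-t)*g0+t*g1 = 0 ∧ 0 ≤ (1-t)*f0+t*f1)) := by
  have hc : ContinuousOn (fun t : ℝ => min ((1-t)*f0+t*f1) ((1-t)*g0+t*g1)) (Set.Icc 0 1) := by fun_prop
  have := intermediate_value_Icc' (zero_le_one) hc
  have h0 : (0:ℝ) ∈ Set.Icc (min ((1-1)*f0+1*f1) ((1-1)*g0+1*g1)) (min ((1-0)*f0+0*f1) ((1-0)*g0+0*g1)) := by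
    constructor
    · rcases h with h | h
      · exact (min_le_left _ _).trans (by linarith)
      · exact (min_le_right _ _).trans (by linarith)
    · apply le_min <;> linarith
  obtain ⟨t, ⟨ht0, ht1⟩, ht⟩ := this h0
  simp only at ht
  have hpos : 0 < t := by
    rcases ht0.eq_or_lt with rfl | h
    · have : 0 < min ((1-0)*f0+0*f1) ((1-0)*g0+0*g1) := lt_min (by linarith) (by linarith)
      linarith
    · exact h
  refine ⟨t, hpos, ht1, ?_⟩
  rcases le_total ((1-t)*f0+t*f1) ((1-t)*g0+t*g1) with h' | h'
  · rw [min_eq_left h'] at ht; left; exact ⟨ht, by linarith⟩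
  · rw [min_eq_right h'] at ht; right; exact ⟨ht, by linarith⟩

lemma seg2_sub {e : Sym2 Pt} {x y : Pt} (hx : x ∈ seg2 e) (hy : y ∈ seg2 e) : segment ℝ x y ⊆ seg2 e := by
  induction e using Sym2.ind with
  | _ u v => exact (convex_segment u v).segment_subset hx hy

lemma mem_seg2 {e : Sym2 Pt} {x : Pt} (hx : x ∈ e) : x ∈ seg2 e := by
  induction e using Sym2.ind with
  | _ u v =>
    rw [seg2_mk]
    rcases Sym2.mem_iff.1 hx with rfl | rfl
    · exact left_mem_segment _ _ _
    · exact right_mem_segment _ _ _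

lemma vis_core {S : Finset Pt} (T : PlaneGraph S) {σ : ℝ} (hσ : σ ≠ 0)
    {p a b s : Pt} (hb : b ∈ S) (hab : 0 < σ * dt p a b)
    (H1 : ∀ e ∈ T.edges, ∀ y ∈ seg2 e, 0 < σ * dt p a y → 0 < σ * dt a b y → ∀ w ∈ seg2 e,
      (w ∈ segment ℝ p a ∨ w ∈ segment ℝ a b) → w = p ∨ w = b)
    (hs1 : 0 < σ * dt p a s) (hs2 : 0 ≤ σ * dt a b s) (hs3 : 0 ≤ σ * dt b p s)
    (hmin : ∀ t ∈ S, 0 < σ * dt p a t → 0 ≤ σ * dt a b t → 0 ≤ σ * dt b p t → 0 ≤ σ * dt p s t)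
    {e : Sym2 Pt} (he : e ∈ T.edges) {y u : Pt} (hy : y ∈ openSegment ℝ p s) (hye : y ∈ seg2 e)
    (hu : u ∈ e) (hus : σ * dt p s u < 0) : False := by
  have huS := T.endpoint_mem e he u hu
  obtain ⟨τ, hτ0, hτ1, hy1, hy2⟩ := mem_oseg.1 hy
  have hpa : p ≠ a := by rintro rfl; rw [dt_self3] at hab; simp at hab
  have habne : a ≠ b := by rintro rfl; rw [dt_self2] at hab; simp at hab
  have f0 : 0 < σ * dt p a y := by
    rw [dt_comb p a p s y τ hy1 hy2, dt_self1]
    have := mul_pos hτ0 hs1; linarith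
  have g0 : 0 < σ * dt a b y := by
    rw [dt_comb a b p s y τ hy1 hy2, dt_rot p a b]
    have := mul_pos (sub_pos.2 hτ1) hab
    have := mul_nonneg hτ0.le hs2; linarith
  have hsb : 0 ≤ σ * dt p s b := hmin b hb hab (by rw [dt_self2]; simp) (by rw [dt_self1]; simp)
  have hsa : σ * dt p s a < 0 := by rw [dt_swap']; linarith
  by_cases hm : σ * dt p a u ≤ 0 ∨ σ * dt a b u ≤ 0
  · obtain ⟨t, ht0, ht1, hcase⟩ := ivt2 f0 g0 hm
    set w : Pt := ((1-t)*y.1+t*u.1, (1-t)*y.2+t*u.2) with hw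
    have hwe : w ∈ seg2 e := seg2_sub hye (mem_seg2 hu) (mem_seg.2 ⟨t, ht0.le, ht1, rfl, rfl⟩)
    have hd : ∀ c d : Pt, dt c d w = (1-t)*dt c d y + t * dt c d u := fun c d => dt_comb c d y u w t rfl rfl
    have hpsw : σ * dt p s w < 0 := by
      rw [hd, oseg_dt (openSegment_subset_segment ℝ _ _ hy)]
      have := mul_neg_of_pos_of_neg ht0 hus
      linarith
    have fin : (w ∈ segment ℝ p a ∨ w ∈ segment ℝ a b) → False := by
      intro h
      rcases H1 e he y hye f0 g0 w hwe h with h | h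
      · rw [h, dt_self1] at hpsw; simp at hpsw
      · rw [h] at hpsw; linarith
    rcases hcase with ⟨h1, h2⟩ | ⟨h1, h2⟩
    · have e1 : dt p a w = 0 := by
        have : σ * dt p a w = 0 := by rw [hd]; linarith
        exact (mul_eq_zero.1 this).resolve_left hσ
      have e2 : 0 ≤ σ * dt a b w := by rw [hd]; linarith
      obtain ⟨l, l1, l2⟩ := line_param hpa e1
      apply fin; left
      refine mem_seg.2 ⟨l, ?_, ?_, l1, l2⟩
      · rw [dt_comb p s p a w l l1 l2, dt_self1] at hpsw
        nlinarith
      · rw [dt_comb a b p a w l l1 l2, dt_self1, dt_rot p a b] at e2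
        nlinarith
    · have e1 : dt a b w = 0 := by
        have : σ * dt a b w = 0 := by rw [hd]; linarith
        exact (mul_eq_zero.1 this).resolve_left hσ
      have e2 : 0 ≤ σ * dt p a w := by rw [hd]; linarith
      obtain ⟨l, l1, l2⟩ := line_param habne e1
      apply fin; right
      refine mem_seg.2 ⟨l, ?_, ?_, l1, l2⟩
      · rw [dt_comb p a a b w l l1 l2, dt_self2] at e2
        nlinarith
      · rw [dt_comb p s a b w l l1 l2] at hpsw
        nlinarith
  · push Not at hm
    obtain ⟨h1, h2⟩ := hm
    have h3 : 0 ≤ σ * dt b p u := by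
      have e1 : dt b p u = dt p u b := dt_rot b p u |>.symm ▸ rfl
      have e2 : dt b p s = dt p s b := dt_rot b p s |>.symm ▸ rfl
      rw [e1]
      rw [e2] at hs3
      have := plσ σ p a s u b
      have k1 := mul_nonneg h1.le hs3
      have k2 := mul_neg_of_pos_of_neg hab hus
      have : 0 ≤ (σ * dt p a s) * (σ * dt p u b) := by linarith
      exact nonneg_of_mul_nonneg_right this hs1
    have := hmin u huS h1 h2.le h3
    linarith

lemma vis {S : Finset Pt} (hS : GenPos S) {T : PlaneGraph S} (hT : IsTriangulation T) {σ : ℝ} (hσ : σ ≠ 0)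
    {p a b : Pt} (hp : p ∈ S) (hb : b ∈ S) (hab : 0 < σ * dt p a b)
    (H1 : ∀ e ∈ T.edges, ∀ y ∈ seg2 e, 0 < σ * dt p a y → 0 < σ * dt a b y → ∀ w ∈ seg2 e,
      (w ∈ segment ℝ p a ∨ w ∈ segment ℝ a b) → w = p ∨ w = b) :
    ∃ s ∈ S, s(p,s) ∈ T.edges ∧ 0 < σ * dt p a s ∧ 0 ≤ σ * dt a b s ∧ 0 ≤ σ * dt b p s ∧
    ∀ t ∈ S, 0 < σ * dt p a t → 0 ≤ σ * dt a b t → 0 ≤ σ * dt b p t → 0 ≤ σ * dt p s t := by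
  set X := S.filter (fun t => 0 < σ * dt p a t ∧ 0 ≤ σ * dt a b t ∧ 0 ≤ σ * dt b p t) with hX
  have hXn : X.Nonempty := ⟨b, by simp [hX, hb, hab, dt_self1, dt_self2]⟩
  obtain ⟨s, hs, hmin⟩ := ang_sig hσ hXn (p := p) (σ * -(a.2-p.2)) (σ * (a.1-p.1)) (by
    intro r hr
    have := (Finset.mem_filter.1 hr).2.1
    unfold dt at this; linarith)
  obtain ⟨hsS, hs1, hs2, hs3⟩ := Finset.mem_filter.1 hs
  have hmin' : ∀ t ∈ S, 0 < σ * dt p a t → 0 ≤ σ * dt a b t → 0 ≤ σ * dt b p t → 0 ≤ σ * dt p s t :=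
    fun t ht h1 h2 h3 => hmin t (Finset.mem_filter.2 ⟨ht, h1, h2, h3⟩)
  refine ⟨s, hsS, ?_, hs1, hs2, hs3, hmin'⟩
  have hps : p ≠ s := by rintro rfl; rw [dt_self1] at hs1; simp at hs1
  apply maxi hS hT hp hsS hps
  intro e he hne y hy hye
  have hyS := oseg_notS hS hp hsS hps hy
  have core := fun u hu => vis_core T hσ hb hab H1 hs1 hs2 hs3 hmin' he (u := u) hy hye hu
  induction e using Sym2.ind with
  | _ u v =>
  have hu := T.endpoint_mem _ he u (by simp)
  have hv := T.endpoint_mem _ he v (by simp)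
  have huv : u ≠ v := fun h => T.not_isDiag _ he (by simpa using h)
  have cu := not_lt.1 (core u (by simp))
  have cv := not_lt.1 (core v (by simp))
  have h0 := oseg_dt (openSegment_subset_segment ℝ _ _ hy)
  rcases seg_cases hye with rfl | rfl | hye'
  · exact hyS hu
  · exact hyS hv
  obtain ⟨t, ht0, ht1, k1, k2⟩ := mem_oseg.1 hye'
  rw [dt_comb p s u v y t k1 k2] at h0
  have h0' : (1-t) * (σ * dt p s u) + t * (σ * dt p s v) = 0 := by linear_combination σ * h0
  have z1 : σ * dt p s u = 0 := by nlinarith [mul_nonneg ht0.le cv, mul_nonneg (sub_pos.2 ht1).le cu]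
  have z2 : σ * dt p s v = 0 := by
    rw [z1] at h0'
    have : t * (σ * dt p s v) = 0 := by linarith
    exact (mul_eq_zero.1 this).resolve_left ht0.ne'
  have q1 := gp_zero hS hp hsS hu hps ((mul_eq_zero.1 z1).resolve_left hσ)
  have q2 := gp_zero hS hp hsS hv hps ((mul_eq_zero.1 z2).resolve_left hσ)
  rcases q1 with rfl | rfl <;> rcases q2 with rfl | rfl
  · exact huv rfl
  · exact hne rfl
  · exact hne Sym2.eq_swap
  · exact huv rfl

lemma edge_ne {S : Finset Pt} (T : PlaneGraph S) {u v : Pt} (h : s(u,v) ∈ T.edges) : u ≠ v :=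
  fun h' => T.not_isDiag _ h (by simpa using h')
lemma edge_l {S : Finset Pt} (T : PlaneGraph S) {u v : Pt} (h : s(u,v) ∈ T.edges) : u ∈ S :=
  T.endpoint_mem _ h u (by simp)
lemma edge_r {S : Finset Pt} (T : PlaneGraph S) {u v : Pt} (h : s(u,v) ∈ T.edges) : v ∈ S :=
  T.endpoint_mem _ h v (by simp)

lemma edge_thru {S : Finset Pt} (hS : GenPos S) (T : PlaneGraph S) {p s w : Pt} {e : Sym2 Pt}
    (hs : s ∈ S) (hps : p ≠ s) (he : e ∈ T.edges) (hpe : p ∈ e) (hw : w ∈ segment ℝ p s) (hwp : w ≠ p)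
    (hwe : w ∈ seg2 e) : e = s(p,s) := by
  obtain ⟨v, rfl⟩ := Sym2.mem_iff_exists.1 hpe
  rw [seg2_mk] at hwe
  have h0 := oseg_dt hw
  obtain ⟨t, _, _, k1, k2⟩ := mem_seg.1 hwe
  rw [dt_comb p s p v w t k1 k2, dt_self1] at h0
  have ht : t ≠ 0 := by
    rintro rfl
    exact hwp (Prod.ext (by simpa using k1) (by simpa using k2))
  have : dt p s v = 0 := by
    have : t * dt p s v = 0 := by linarith
    exact (mul_eq_zero.1 this).resolve_left ht
  rcases gp_zero hS (edge_l T he) hs (edge_r T he) hps this with h | h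
  · exact absurd h.symm (edge_ne T he)
  · rw [h]

set_option maxHeartbeats 1000000 in
lemma halfplane {S : Finset Pt} (hS : GenPos S) {T : PlaneGraph S} (hT : IsTriangulation T) (A B : ℝ)
    {p s : Pt} (hp : p ∈ S) (hs : s ∈ S) (h : 0 < A*(s.1-p.1)+B*(s.2-p.2)) :
    ∃ n ∈ S, s(p,n) ∈ T.edges ∧ 0 < A*(n.1-p.1)+B*(n.2-p.2) := by
  by_contra hno
  push Not at hno
  have hps : p ≠ s := by rintro rfl; simp at h
  have hnT : s(p,s) ∉ T.edges := fun h' => by have := hno s hs h'; linarith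
  set g : Pt → ℝ := fun x => A*(x.1-p.1)+B*(x.2-p.2) with hg
  have gcomb : ∀ (u v w : Pt) (t : ℝ), w.1 = (1-t)*u.1+t*v.1 → w.2 = (1-t)*u.2+t*v.2 →
      g w = (1-t) * g u + t * g v := by
    intro u v w t h1 h2; simp only [hg, h1, h2]; ring
  have gp : g p = 0 := by simp [hg]
  have hex : ∃ e ∈ T.edges, e ≠ s(p,s) ∧ ∃ z ∈ openSegment ℝ p s, z ∈ seg2 e := by
    by_contra hc
    push Not at hc
    exact hnT (maxi hS hT hp hs hps hc)
  obtain ⟨e1, he1, hne1, z, hz, hze⟩ := hex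
  set K : Set Pt := segment ℝ p s ∩ ⋃ e ∈ (T.edges.filter (fun e => p ∉ e) : Finset (Sym2 Pt)), seg2 e with hK
  have segc : ∀ u v : Pt, IsCompact (segment ℝ u v) := by
    intro u v
    rw [← convexHull_pair]
    exact Set.Finite.isCompact_convexHull ℝ (by simp)
  have hKc : IsCompact K := by
    apply (segc p s).inter
    apply Finset.isCompact_biUnion
    intro e _
    induction e using Sym2.ind with
    | _ u v => exact segc u v
  have hKm : ∀ w, w ∈ segment ℝ p s → w ≠ p → ∀ e ∈ T.edges, w ∈ seg2 e → w ∈ K := by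
    intro w hw hwp e he hwe
    refine ⟨hw, Set.mem_biUnion (x := e) ?_ hwe⟩
    simp only [Finset.coe_filter, Set.mem_ofPred_eq]
    refine ⟨he, fun hpe => ?_⟩
    have := edge_thru hS T hs hps he hpe hw hwp hwe
    rw [this] at he; exact hnT he
  have hzK : z ∈ K := hKm z (openSegment_subset_segment ℝ _ _ hz) (oseg_ne hps hz).1 e1 he1 hze
  obtain ⟨x, hxK, hxmin⟩ := hKc.exists_isMinOn ⟨z, hzK⟩ (f := g) (by simp only [hg]; fun_prop)
  have hxmin' : ∀ w ∈ K, g x ≤ g w := fun w hw => hxmin hw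
  obtain ⟨hxs, hxU⟩ := hxK
  simp only [Finset.mem_filter, Set.mem_iUnion, exists_prop] at hxU
  obtain ⟨e0, ⟨he0, hpe0⟩, hxe0⟩ := hxU
  have hxp : x ≠ p := by
    rintro rfl
    exact hpe0 (onedge hS T he0 hp hxe0)
  obtain ⟨t, ht0, ht1, hx1, hx2⟩ := mem_seg.1 hxs
  have htpos : 0 < t := by
    rcases ht0.eq_or_lt with rfl | h
    · exact absurd (Prod.ext (by simpa using hx1) (by simpa using hx2)) hxp
    · exact h
  have hgs : 0 < g s := h
  have hgx : g x = t * g s := by rw [gcomb p s x t hx1 hx2, gp]; ring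
  have htlt : t < 1 := by
    have h1 := hxmin' z hzK
    obtain ⟨t', h0', h1', hz1, hz2⟩ := mem_oseg.1 hz
    have : g z = t' * g s := by rw [gcomb p s z t' hz1 hz2, gp]; ring
    nlinarith
  have hxo : x ∈ openSegment ℝ p s := mem_oseg.2 ⟨t, htpos, htlt, hx1, hx2⟩
  have hxS := oseg_notS hS hp hs hps hxo
  have hgx0 : 0 < g x := by rw [hgx]; positivity
  have hob : ∃ o b, e0 = s(o,b) ∧ 0 < g b := by
    clear hxmin hxmin'
    induction e0 using Sym2.ind with
    | _ u v =>
    obtain ⟨r, hr0, hr1, k1, k2⟩ := mem_seg.1 (show x ∈ segment ℝ u v from hxe0)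
    rw [gcomb u v x r k1 k2] at hgx0
    by_cases hv : 0 < g v
    · exact ⟨u, v, rfl, hv⟩
    · refine ⟨v, u, Sym2.eq_swap, ?_⟩
      push Not at hv
      by_contra hu
      push Not at hu
      nlinarith [mul_nonneg hr0 (neg_nonneg.2 hv), mul_nonneg (sub_nonneg.2 hr1) (neg_nonneg.2 hu)]
  obtain ⟨o, b, rfl, hgb⟩ := hob
  have hoS := edge_l T he0
  have hbS := edge_r T he0
  have hobne := edge_ne T he0
  have hxob : x ∈ openSegment ℝ o b := by
    rcases seg_cases hxe0 with h | h | h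
    · rw [h] at hxS; exact absurd hoS hxS
    · rw [h] at hxS; exact absurd hbS hxS
    · exact h
  obtain ⟨r, hr0, hr1, k1, k2⟩ := mem_oseg.1 hxob
  have hbp : b ≠ p := by rintro rfl; rw [gp] at hgb; simp at hgb
  have hσ : dt p x b ≠ 0 := by
    intro h0
    have e : dt p x b = t * dt p s b := by
      rw [← dt_rot p x b, ← dt_rot x b p, dt_comb b p p s x t hx1 hx2, dt_self2, ← dt_rot b p s]; 
      unfold dt; ring
    rw [e] at h0
    have h0 := (mul_eq_zero.1 h0).resolve_left htpos.ne'
    rcases gp_zero hS hp hs hbS hps h0 with h | h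
    · exact hbp h
    · have hz := oseg_dt hxs
      rw [dt_comb p s o b x r k1 k2, h0] at hz
      have : (1-r) * dt p s o = 0 := by linarith
      have := (mul_eq_zero.1 this).resolve_left (by linarith)
      rcases gp_zero hS hp hs hoS hps this with h' | h'
      · apply hpe0; simp [h']
      · exact hobne (h'.trans h.symm)
  obtain ⟨n, hn, hnT', hn1, hn2, hn3, _⟩ := vis hS hT hσ hp hbS (a := x) (mul_self_pos.2 hσ) (by
    intro e' he' y hy hy1 hy2 w hw hcase
    have hee : s(o,b) ≠ e' := by
      rintro rfl
      have h0 := oseg_dt (show y ∈ segment ℝ o b from hy)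
      have : dt x b y = 0 := by
        have e : dt x b y = dt b y x := by unfold dt; ring
        rw [e, dt_comb b y o b x r k1 k2, dt_self1]
        have e : dt b y o = dt o b y := by unfold dt; ring
        rw [e, h0]; ring
      rw [this] at hy2; simp at hy2
    have nc := T.noncrossing _ he0 _ he' hee
    have second : w ∈ segment ℝ x b → w = p ∨ w = b := by
      intro hwx
      have hw0 : w ∈ seg2 s(o,b) := seg2_sub hxe0 (mem_seg2 (by simp)) hwx
      rcases Sym2.mem_iff.1 (nc w ⟨hw0, hw⟩).1 with h | h
      · exfalso
        rw [h] at hwx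
        obtain ⟨l, hl0, hl1, m1, m2⟩ := mem_seg.1 hwx
        have hpos : (1 - (1-l)*(1-r)) ≠ 0 := by nlinarith
        rw [k1] at m1
        rw [k2] at m2
        have a : (1 - (1-l)*(1-r)) * (o.1 - b.1) = 0 := by linarith
        have b' : (1 - (1-l)*(1-r)) * (o.2 - b.2) = 0 := by linarith
        have a := (mul_eq_zero.1 a).resolve_left hpos
        have b' := (mul_eq_zero.1 b').resolve_left hpos
        exact hobne (Prod.ext (by linarith) (by linarith))
      · exact Or.inr h
    rcases hcase with hwx | hwx
    · by_cases hwp : w = p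
      · exact Or.inl hwp
      · have hws : w ∈ segment ℝ p s :=
          (convex_segment p s).segment_subset (left_mem_segment _ _ _) hxs hwx
        have := hxmin' w (hKm w hws hwp e' he' hw)
        obtain ⟨l, hl0, hl1, m1, m2⟩ := mem_seg.1 hwx
        rw [gcomb p x w l m1 m2, gp] at this
        have hl : l = 1 := by nlinarith
        subst hl
        apply second
        have : w = x := Prod.ext (by simpa using m1) (by simpa using m2)
        rw [this]; exact left_mem_segment _ _ _
    · exact second hwx)
  have := hno n hn hnT'
  have id1 : dt p x b * dt p x b * g n = (dt p x b * dt b p n) * g x + (dt p x b * dt p x n) * g b := by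
    simp only [hg]; unfold dt; ring
  have : 0 < dt p x b * dt p x b * g n := by
    rw [id1]
    have := mul_nonneg hn3 hgx0.le
    have := mul_pos hn1 hgb
    linarith
  have h2 := (mul_pos_iff_of_pos_left (mul_self_pos.2 hσ)).1 this
  have h3 : g n ≤ 0 := hno n hn hnT'
  linarith

lemma face_ex {S : Finset Pt} (hS : GenPos S) {T : PlaneGraph S} (hT : IsTriangulation T)
    {p q s₀ : Pt} (hpq : s(p,q) ∈ T.edges) (hs₀ : s₀ ∈ S) (h₀ : 0 < dt p q s₀) :
    ∃ r ∈ S, 0 < dt p q r ∧ s(p,r) ∈ T.edges ∧ s(q,r) ∈ T.edges ∧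
      ∀ t ∈ S, 0 ≤ dt p q t → 0 ≤ dt q r t → 0 ≤ dt r p t → t = p ∨ t = q ∨ t = r := by
  have hp := edge_l T hpq
  have hq := edge_r T hpq
  have hne := edge_ne T hpq
  set X := S.filter (fun t => s(p,t) ∈ T.edges ∧ 0 < dt p q t) with hX
  have form : ∀ t, dt p q t = (-(q.2-p.2))*(t.1-p.1) + (q.1-p.1)*(t.2-p.2) := by
    intro t; unfold dt; ring
  have hXn : X.Nonempty := by
    obtain ⟨n, hn, h1, h2⟩ := halfplane hS hT (-(q.2-p.2)) (q.1-p.1) hp hs₀ (by rw [← form]; exact h₀)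
    exact ⟨n, Finset.mem_filter.2 ⟨hn, h1, by rw [form]; exact h2⟩⟩
  obtain ⟨r, hr, hrmin⟩ := ang_min hXn (p := p) (-(q.2-p.2)) (q.1-p.1) (by
    intro t ht
    rw [← form]; exact (Finset.mem_filter.1 ht).2.2)
  obtain ⟨hrS, hprT, hr0⟩ := Finset.mem_filter.1 hr
  have hnext : ∀ v, s(p,v) ∈ T.edges → 0 < dt p q v → 0 ≤ dt p r v := fun v hv h =>
    hrmin v (Finset.mem_filter.2 ⟨edge_r T hv, hv, h⟩)
  have hpr := edge_ne T hprT
  obtain ⟨s, hsS, hqs, hs1, hs2, hs3, hsmin⟩ := vis hS hT (σ := -1) (by norm_num) hq hrS (a := p)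
    (by rw [dt_swap]; linarith) (by
    intro e he y hy hy1 hy2 w hw hcase
    rw [dt_swap] at hy1
    have hpe : p ∉ e := by
      intro hpe
      obtain ⟨v, rfl⟩ := Sym2.mem_iff_exists.1 hpe
      obtain ⟨t, ht0, ht1, k1, k2⟩ := mem_seg.1 (show y ∈ segment ℝ p v from hy)
      rw [dt_comb p q p v y t k1 k2, dt_self1] at hy1
      rw [dt_comb p r p v y t k1 k2, dt_self1] at hy2
      have h1 : 0 < dt p q v := by
        by_contra hc; push Not at hc; nlinarith
      have := hnext v he h1
      nlinarith
    rcases hcase with hc | hc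
    · have hee : s(p,q) ≠ e := by rintro rfl; exact hpe (by simp)
      rw [segment_symm] at hc
      obtain ⟨h1, h2⟩ := T.noncrossing _ hpq _ he hee w ⟨hc, hw⟩
      rcases Sym2.mem_iff.1 h1 with rfl | h
      · exact absurd h2 hpe
      · exact Or.inl h
    · have hee : s(p,r) ≠ e := by rintro rfl; exact hpe (by simp)
      obtain ⟨h1, h2⟩ := T.noncrossing _ hprT _ he hee w ⟨hc, hw⟩
      rcases Sym2.mem_iff.1 h1 with rfl | h
      · exact absurd h2 hpe
      · exact Or.inr h)
  have hs1' : 0 < dt p q s := by rw [dt_swap] at hs1; linarith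
  have hs2' : 0 ≤ dt r p s := by rw [dt_swap]; linarith
  have hs3' : 0 ≤ dt q r s := by rw [dt_swap]; linarith
  have hqne : q ≠ s := edge_ne T hqs
  have hqr : q ≠ r := by rintro rfl; rw [dt_self2] at hr0; simp at hr0
  have hsmin' : ∀ t ∈ S, 0 < dt p q t → 0 ≤ dt q r t → 0 ≤ dt r p t → dt q s t ≤ 0 := by
    intro t ht h1 h2 h3
    have := hsmin t ht (by rw [dt_swap]; linarith) (by rw [dt_swap]; linarith) (by rw [dt_swap]; linarith)
    linarith
  by_cases hsr : s = r
  · subst hsr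
    refine ⟨s, hsS, hr0, hprT, hqs, ?_⟩
    intro t ht h1 h2 h3
    rcases h1.eq_or_lt with h | h
    · rcases gp_zero hS hp hq ht hne h.symm with h | h <;> simp [h]
    · have := hsmin' t ht h h2 h3
      rcases gp_zero hS hq hsS ht hqne (le_antisymm this h2) with h | h <;> simp [h]
  · exfalso
    have hsp : s ≠ p := by rintro rfl; rw [dt_self1] at hs1'; simp at hs1'
    have hs2'' : 0 < dt r p s := lt_of_le_of_ne hs2' (Ne.symm (gp_dt hS hrS hp hsS hpr.symm (Ne.symm hsr) hsp.symm))
    have hs3'' : 0 < dt q r s := lt_of_le_of_ne hs3' (Ne.symm (gp_dt hS hq hrS hsS hqr hqne (Ne.symm hsr)))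
    obtain ⟨n, hnS, hpn, hn1, hn2, hn3, _⟩ := vis hS hT (σ := 1) (by norm_num) hp hsS (a := q)
      (by linarith) (by
      intro e he y hy hy1 hy2 w hw hcase
      rw [one_mul] at hy1 hy2
      have hqe : q ∉ e := by
        intro hqe
        obtain ⟨v, rfl⟩ := Sym2.mem_iff_exists.1 hqe
        obtain ⟨t, ht0, ht1, k1, k2⟩ := mem_seg.1 (show y ∈ segment ℝ q v from hy)
        rw [dt_comb p q q v y t k1 k2, dt_self2] at hy1
        rw [dt_comb q s q v y t k1 k2, dt_self1] at hy2
        have h1 : 0 < dt p q v := by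
          by_contra hc; push Not at hc; nlinarith
        have h2 : 0 < dt q s v := by
          by_contra hc; push Not at hc; nlinarith
        -- v lies in the cone at q spanned by r and p
        have h3 : 0 < dt q r v := by
          have := pl q r s v p
          have e1 : dt q v p = dt p q v := dt_rot p q v
          have e2 : dt q s p = dt p q s := dt_rot p q s
          have e3 : dt q r p = dt p q r := dt_rot p q r
          rw [e1, e2, e3] at this
          by_contra hc
          push Not at hc
          nlinarith [mul_pos hs3'' h1, mul_pos hr0 h2, mul_nonneg (neg_nonneg.2 hc) hs1'.le]
        have hvS := edge_r T he
        by_cases h4 : 0 ≤ dt r p v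
        · have := hsmin' v hvS h1 h3.le h4
          linarith
        · push Not at h4
          -- qv crosses pr
          have hrq : 0 ≤ dt r p q := by
            have : dt r p q = dt p q r := by unfold dt; ring
            linarith
          obtain ⟨x, hx, hx0⟩ := cross_line hrq h4
          obtain ⟨l, hl0, hl1, m1, m2⟩ := mem_seg.1 hx
          have c1 : dt p q x = l * dt p q v := by rw [dt_comb p q q v x l m1 m2, dt_self2]; ring
          have c2 : dt q r x = l * dt q r v := by rw [dt_comb q r q v x l m1 m2, dt_self1]; ring
          have hl : 0 < l := by
            rcases hl0.eq_or_lt with rfl | h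
            · exfalso
              have : x = q := Prod.ext (by simpa using m1) (by simpa using m2)
              rw [this] at hx0
              have : dt r p q = dt p q r := by unfold dt; ring
              linarith
            · exact h
          have c1' : 0 < dt p q x := by rw [c1]; positivity
          have c2' : 0 < dt q r x := by rw [c2]; positivity
          have hxpr : x ∈ segment ℝ p r := by
            have h0 : dt p r x = 0 := by rw [dt_swap]; linarith
            obtain ⟨k, kk1, kk2⟩ := line_param hpr h0
            refine mem_seg.2 ⟨k, ?_, ?_, kk1, kk2⟩
            · rw [dt_comb p q p r x k kk1 kk2, dt_self1] at c1'
              by_contra hc; push Not at hc; nlinarith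
            · rw [dt_comb q r p r x k kk1 kk2, dt_self2] at c2'
              have : dt q r p = dt p q r := dt_rot p q r
              rw [this] at c2'
              by_contra hc; push Not at hc; nlinarith
          have hee : s(p,r) ≠ s(q,v) := by
            intro h
            have : q ∈ s(p,r) := by rw [h]; simp
            rcases Sym2.mem_iff.1 this with h | h
            · exact hne h.symm
            · exact hqr h
          have := (T.noncrossing _ hprT _ he hee x ⟨hxpr, hx⟩).1
          rcases Sym2.mem_iff.1 this with h | h
          · rw [h, dt_self1] at c1'; simp at c1'
          · rw [h, dt_self2] at c2'; simp at c2'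
      rcases hcase with hc | hc
      · have hee : s(p,q) ≠ e := by rintro rfl; exact hqe (by simp)
        obtain ⟨h1, h2⟩ := T.noncrossing _ hpq _ he hee w ⟨hc, hw⟩
        rcases Sym2.mem_iff.1 h1 with h | rfl
        · exact Or.inl h
        · exact absurd h2 hqe
      · have hee : s(q,s) ≠ e := by rintro rfl; exact hqe (by simp)
        obtain ⟨h1, h2⟩ := T.noncrossing _ hqs _ he hee w ⟨hc, hw⟩
        rcases Sym2.mem_iff.1 h1 with rfl | h
        · exact absurd h2 hqe
        · exact Or.inr h)
    rw [one_mul] at hn1 hn2 hn3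
    have h1 := hnext n hpn hn1
    have e1 : dt s p n = - dt p s n := dt_swap p s n
    have e2 : dt r p s = - dt p r s := dt_swap p r s
    have := pl p q r s n
    -- [qr][sn] - [qs][rn] + [qn][rs] = 0
    nlinarith [mul_pos hn1 hs2'', mul_nonneg hs1'.le h1, mul_nonneg hr0.le hn3]

/-- directed left edge of a polygon -/
def LE' (Q : Finset Pt) (p q : Pt) : Prop := p ∈ Q ∧ q ∈ Q ∧ p ≠ q ∧ ∀ r ∈ Q, 0 ≤ dt p q r

lemma diag_int {s : Set Pt} (hs : Convex ℝ s) {p q c d : Pt} (hp : p ∈ s) (hq : q ∈ s) (hc : c ∈ s) (hd : d ∈ s)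
    (h1 : 0 < dt p q c) (h2 : dt p q d < 0) : openSegment ℝ p q ⊆ interior s := by
  intro m hm
  obtain ⟨t, h0, h1', k1, k2⟩ := mem_oseg.1 hm
  have e1 : dt q c m = (1-t) * dt p q c := by
    rw [dt_comb q c p q m t k1 k2, dt_self1, dt_rot p q c]; ring
  have e2 : dt c p m = t * dt p q c := by
    rw [dt_comb c p p q m t k1 k2, dt_self2]; unfold dt; ring
  have e3 : dt p d m = t * (-dt p q d) := by
    rw [dt_comb p d p q m t k1 k2, dt_self1]; unfold dt; ring
  have e4 : dt d q m = (1-t) * (-dt p q d) := by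
    rw [dt_comb d q p q m t k1 k2, dt_self2]; unfold dt; ring
  rw [mem_interior]
  refine ⟨{z | 0 < dt q c z} ∩ {z | 0 < dt c p z} ∩ ({z | 0 < dt p d z} ∩ {z | 0 < dt d q z}), ?_, ?_, ?_⟩
  · rintro z ⟨⟨a1, a2⟩, a3, a4⟩
    simp only [Set.mem_ofPred_eq] at a1 a2 a3 a4
    rcases le_total 0 (dt p q z) with h | h
    · exact tri_mem' hs hp hq hc h1 h a1.le a2.le
    · have := dt_swap p q z
      have := dt_swap p q d
      exact tri_mem' hs hq hp hd (by linarith) (by linarith) a3.le a4.le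
  · exact ((isOpen_lt continuous_const (dt_cont _ _)).inter (isOpen_lt continuous_const (dt_cont _ _))).inter
      ((isOpen_lt continuous_const (dt_cont _ _)).inter (isOpen_lt continuous_const (dt_cont _ _)))
  · refine ⟨⟨?_, ?_⟩, ?_, ?_⟩ <;> simp only [Set.mem_ofPred_eq, e1, e2, e3, e4] <;> apply mul_pos <;> linarith

def mid (p q : Pt) : Pt := ((p.1+q.1)/2, (p.2+q.2)/2)
lemma mid_oseg (p q : Pt) : mid p q ∈ openSegment ℝ p q :=
  mem_oseg.2 ⟨1/2, by norm_num, by norm_num, by simp only [mid]; ring, by simp only [mid]; ring⟩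

lemma hull_edge {Q : Finset Pt} {p q : Pt} (h : IsHullEdgeOf Q p q) : LE' Q p q ∨ LE' Q q p := by
  obtain ⟨hp, hq, hne, hf⟩ := h
  by_contra hc
  simp only [LE', not_or, not_and, not_forall] at hc
  obtain ⟨d, hd, h1⟩ := hc.1 hp hq hne
  obtain ⟨c, hc', h2⟩ := hc.2 hq hp hne.symm
  rw [dt_swap] at h2
  have := diag_int (convex_convexHull ℝ (Q : Set Pt)) (subset_convexHull ℝ _ hp) (subset_convexHull ℝ _ hq)
    (subset_convexHull ℝ _ hc') (subset_convexHull ℝ _ hd) (by linarith) (by linarith) (mid_oseg p q)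
  exact (hf (openSegment_subset_segment ℝ _ _ (mid_oseg p q))).2 this

/-- two convex sets on the same side of a common edge overlap -/
lemma same_side {s s' : Set Pt} (hs : Convex ℝ s) (hs' : Convex ℝ s') {p q c c' : Pt} (hp : p ∈ s) (hq : q ∈ s)
    (hp' : p ∈ s') (hq' : q ∈ s') (hc : c ∈ s) (hc' : c' ∈ s') (h : 0 < dt p q c) (h' : 0 < dt p q c') :
    (interior s ∩ interior s').Nonempty := by
  have e1 : 0 < dt q c (mid p q) := by
    have : dt q c (mid p q) = dt p q c / 2 := by simp only [mid, dt]; ring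
    rw [this]; positivity
  have e2 : 0 < dt c p (mid p q) := by
    have : dt c p (mid p q) = dt p q c / 2 := by simp only [mid, dt]; ring
    rw [this]; positivity
  have e3 : 0 < dt q c' (mid p q) := by
    have : dt q c' (mid p q) = dt p q c' / 2 := by simp only [mid, dt]; ring
    rw [this]; positivity
  have e4 : 0 < dt c' p (mid p q) := by
    have : dt c' p (mid p q) = dt p q c' / 2 := by simp only [mid, dt]; ring
    rw [this]; positivity
  have hO : IsOpen ({z | 0 < dt q c z} ∩ {z | 0 < dt c p z} ∩ ({z | 0 < dt q c' z} ∩ {z | 0 < dt c' p z})) :=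
    ((isOpen_lt continuous_const (dt_cont _ _)).inter (isOpen_lt continuous_const (dt_cont _ _))).inter
      ((isOpen_lt continuous_const (dt_cont _ _)).inter (isOpen_lt continuous_const (dt_cont _ _)))
  have hcl : mid p q ∈ closure (openSegment ℝ (mid p q) c) := by
    exact segment_subset_closure_openSegment (left_mem_segment _ _ _)
  obtain ⟨z, hz, hzo⟩ := mem_closure_iff.1 hcl _ hO ⟨⟨e1, e2⟩, e3, e4⟩
  obtain ⟨t, h0, h1, k1, k2⟩ := mem_oseg.1 hzo
  have hz0 : 0 < dt p q z := by
    rw [dt_comb p q _ c z t k1 k2, oseg_dt (openSegment_subset_segment ℝ _ _ (mid_oseg p q))]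
    have := mul_pos h0 h
    linarith
  exact ⟨z, tri_int hs hp hq hc h hz0 hz.1.1 hz.1.2, tri_int hs' hp' hq' hc' h' hz0 hz.2.1 hz.2.2⟩

lemma tri_side {a b c x : Pt} (h : 0 < dt a b c) (h1 : dt a b x = 0) (h2 : 0 ≤ dt b c x) (h3 : 0 ≤ dt c a x) :
    x ∈ segment ℝ a b := by
  have hab : a ≠ b := by rintro rfl; rw [dt_self3] at h; simp at h
  obtain ⟨t, k1, k2⟩ := line_param hab h1
  rw [dt_comb b c a b x t k1 k2, dt_self1, dt_rot a b c] at h2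
  rw [dt_comb c a a b x t k1 k2, dt_self2, ← dt_rot c a b] at h3
  refine mem_seg.2 ⟨t, ?_, ?_, k1, k2⟩
  · by_contra hc; push Not at hc; nlinarith
  · by_contra hc; push Not at hc; nlinarith

lemma tri_leave {a b c z u : Pt} (h : 0 < dt a b c) (hz : z ∈ interior (convexHull ℝ ({a,b,c} : Set Pt)))
    (hu : u ∉ convexHull ℝ ({a,b,c} : Set Pt)) :
    ∃ x ∈ openSegment ℝ z u, x ∈ convexHull ℝ ({a,b,c} : Set Pt) ∧
      (x ∈ segment ℝ a b ∨ x ∈ segment ℝ b c ∨ x ∈ segment ℝ c a) := by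
  have hcl : IsClosed (convexHull ℝ ({a,b,c} : Set Pt)) := Set.Finite.isClosed_convexHull ℝ (by simp)
  have hex : ∃ x ∈ segment ℝ z u, x ∈ convexHull ℝ ({a,b,c} : Set Pt) ∧
      x ∉ interior (convexHull ℝ ({a,b,c} : Set Pt)) := by
    by_contra hno
    push Not at hno
    obtain ⟨w, _, hw1, hw2⟩ := (convex_segment (𝕜 := ℝ) z u).isPreconnected _ _
      (isOpen_interior (s := convexHull ℝ ({a,b,c} : Set Pt))) hcl.isOpen_compl (by
        intro x hx
        by_cases hxc : x ∈ convexHull ℝ ({a,b,c} : Set Pt)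
        · exact Or.inl (hno x hx hxc)
        · exact Or.inr hxc) ⟨z, left_mem_segment _ _ _, hz⟩ ⟨u, right_mem_segment _ _ _, hu⟩
    exact hw2 (interior_subset hw1)
  obtain ⟨x, hx, hxc, hxi⟩ := hex
  refine ⟨x, ?_, hxc, ?_⟩
  · rcases seg_cases hx with rfl | rfl | h
    · exact absurd hz hxi
    · exact absurd hxc hu
    · exact h
  · obtain ⟨h1, h2, h3⟩ := tri_dt h hxc
    have r1 := dt_rot a b c
    have r2 := dt_rot b c a
    rcases h1.eq_or_lt with k1 | k1
    · exact Or.inl (tri_side h k1.symm h2 h3)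
    rcases h2.eq_or_lt with k2 | k2
    · exact Or.inr (Or.inl (tri_side (by linarith) k2.symm h3 h1))
    rcases h3.eq_or_lt with k3 | k3
    · exact Or.inr (Or.inr (tri_side (by linarith) k3.symm h1 h2))
    · exact absurd (tri_int (convex_convexHull ℝ _) (subset_convexHull ℝ _ (by simp)) (subset_convexHull ℝ _ (by simp))
        (subset_convexHull ℝ _ (by simp)) h k1 k2 k3) hxi

structure Face {S : Finset Pt} (T : PlaneGraph S) (a b c : Pt) : Prop where
  pos : 0 < dt a b c
  ab : s(a,b) ∈ T.edges
  bc : s(b,c) ∈ T.edges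
  ca : s(c,a) ∈ T.edges
  emp : ∀ t ∈ S, t ∈ convexHull ℝ ({a,b,c} : Set Pt) → t = a ∨ t = b ∨ t = c

lemma face_avoid {S : Finset Pt} {T : PlaneGraph S} {a b c : Pt} (hF : Face T a b c)
    {e : Sym2 Pt} (he : e ∈ T.edges) {z : Pt} (hze : z ∈ seg2 e)
    (hz : z ∈ interior (convexHull ℝ ({a,b,c} : Set Pt))) : False := by
  have r1 := dt_rot a b c
  have r2 := dt_rot b c a
  have i1 := dt_int (edge_ne T hF.ab) (fun r hr => (tri_dt hF.pos hr).1) hz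
  have i2 := dt_int (edge_ne T hF.bc) (fun r hr => (tri_dt hF.pos hr).2.1) hz
  have i3 := dt_int (edge_ne T hF.ca) (fun r hr => (tri_dt hF.pos hr).2.2) hz
  by_cases hall : ∀ u ∈ e, u = a ∨ u = b ∨ u = c
  · induction e using Sym2.ind with
    | _ u v =>
    have huv := edge_ne T he
    have h0 := oseg_dt (show z ∈ segment ℝ u v from hze)
    have s1 := dt_swap a b z
    have s2 := dt_swap b c z
    have s3 := dt_swap c a z
    rcases hall u (by simp) with rfl | rfl | rfl <;> rcases hall v (by simp) with rfl | rfl | rfl <;>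
      first | exact huv rfl | linarith
  · push Not at hall
    obtain ⟨u, hue, hu1, hu2, hu3⟩ := hall
    obtain ⟨v, rfl⟩ := Sym2.mem_iff_exists.1 hue
    have huv := edge_ne T he
    have hun : u ∉ convexHull ℝ ({a,b,c} : Set Pt) := by
      intro h
      rcases hF.emp u (edge_l T he) h with h | h | h <;> contradiction
    obtain ⟨x, hx, hxc, hside⟩ := tri_leave hF.pos hz hun
    have hzu : z ≠ u := by
      rintro rfl; exact hun (interior_subset hz)
    have hxe : x ∈ seg2 s(u,v) := seg2_sub hze (mem_seg2 (by simp)) (openSegment_subset_segment ℝ _ _ hx)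
    have key : ∀ a' b', (a' = a ∨ a' = b ∨ a' = c) → (b' = a ∨ b' = b ∨ b' = c) → s(a',b') ∈ T.edges → x ∈ segment ℝ a' b' → False := by
      intro a' b' ha hb hab hxs
      have hne : s(u,v) ≠ s(a',b') := by
        intro h
        have : u ∈ s(a',b') := by rw [← h]; simp
        rcases Sym2.mem_iff.1 this with rfl | rfl <;> tauto
      have := (T.noncrossing _ he _ hab hne x ⟨hxe, hxs⟩).1
      rcases Sym2.mem_iff.1 this with h | h
      · rw [h] at hx; exact (oseg_ne hzu hx).2 rfl
      · subst h
        obtain ⟨t, h0, h1, k1, k2⟩ := mem_oseg.1 hx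
        obtain ⟨r, l0, l1, m1, m2⟩ := mem_seg.1 (show z ∈ segment ℝ u x from hze)
        have hpos : 1 - (1-t)*r ≠ 0 := by nlinarith
        have e1 : (1 - (1-t)*r) * (x.1 - u.1) = 0 := by rw [m1] at k1; linarith
        have e2 : (1 - (1-t)*r) * (x.2 - u.2) = 0 := by rw [m2] at k2; linarith
        have e1 := (mul_eq_zero.1 e1).resolve_left hpos
        have e2 := (mul_eq_zero.1 e2).resolve_left hpos
        exact huv (Prod.ext (by linarith) (by linarith))
    rcases hside with h | h | h
    · exact key a b (by simp) (by simp) hF.ab h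
    · exact key b c (by simp) (by simp) hF.bc h
    · exact key c a (by simp) (by simp) hF.ca h

lemma face_disj1 {S : Finset Pt} {T : PlaneGraph S} {a b c a' b' c' : Pt} (hF : Face T a b c)
    (hF' : Face T a' b' c') {v z : Pt} (hv : v = a' ∨ v = b' ∨ v = c') (hv' : ¬ (v = a ∨ v = b ∨ v = c))
    (hz : z ∈ interior (convexHull ℝ ({a,b,c} : Set Pt))) (hz' : z ∈ interior (convexHull ℝ ({a',b',c'} : Set Pt))) : False := by
  have hvS : v ∈ S := by
    rcases hv with rfl | rfl | rfl
    · exact edge_l T hF'.ab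
    · exact edge_l T hF'.bc
    · exact edge_l T hF'.ca
  have hvn : v ∉ convexHull ℝ ({a,b,c} : Set Pt) := fun h => hv' (hF.emp v hvS h)
  obtain ⟨x, hx, hxc, hside⟩ := tri_leave hF.pos hz hvn
  have hx' : x ∈ interior (convexHull ℝ ({a',b',c'} : Set Pt)) := by
    refine (convex_convexHull ℝ _).openSegment_interior_self_subset_interior hz' (subset_convexHull ℝ _ ?_) hx
    simpa using hv
  rcases hside with h | h | h
  · exact face_avoid hF' hF.ab h hx'
  · exact face_avoid hF' hF.bc h hx'
  · exact face_avoid hF' hF.ca h hx'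

lemma face_of {S : Finset Pt} (hS : GenPos S) {T : PlaneGraph S} (hT : IsTriangulation T)
    {p q s₀ : Pt} (hpq : s(p,q) ∈ T.edges) (hs₀ : s₀ ∈ S) (h₀ : 0 < dt p q s₀) :
    ∃ r ∈ S, Face T p q r := by
  obtain ⟨r, hr, h1, h2, h3, h4⟩ := face_ex hS hT hpq hs₀ h₀
  refine ⟨r, hr, h1, hpq, h3, by rw [Sym2.eq_swap]; exact h2, ?_⟩
  intro t ht htc
  obtain ⟨k1, k2, k3⟩ := tri_dt h1 htc
  exact h4 t ht k1 k2 k3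

structure Good {S : Finset Pt} (T : PlaneGraph S) (M F : Finset (Sym2 Pt)) (𝒬 : Finset (Finset Pt)) : Prop where
  FT : F ⊆ T.edges
  FM : ∀ e ∈ F, e ∉ M
  sub : ∀ Q ∈ 𝒬, Q ⊆ S
  card : ∀ Q ∈ 𝒬, 3 ≤ Q.card
  cp : ∀ Q ∈ 𝒬, InConvexPosition Q
  le : ∀ Q ∈ 𝒬, ∀ p q, LE' Q p q → s(p,q) ∈ T.edges ∧ s(p,q) ∉ F
  emp : ∀ Q ∈ 𝒬, ∀ t ∈ S, t ∈ convexHull ℝ (Q : Set Pt) → t ∈ Q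
  disj : ∀ Q ∈ 𝒬, ∀ Q' ∈ 𝒬, Q ≠ Q' → ∀ z, z ∈ interior (convexHull ℝ (Q : Set Pt)) →
    z ∈ interior (convexHull ℝ (Q' : Set Pt)) → False
  diag : ∀ e ∈ F, ∃ Q ∈ 𝒬, IsDiagonalOf Q e
  avoid : ∀ e ∈ T.edges, e ∉ F → ∀ Q ∈ 𝒬, ∀ z ∈ seg2 e, z ∉ interior (convexHull ℝ (Q : Set Pt))
  dir : ∀ p q, s(p,q) ∈ T.edges → s(p,q) ∉ F → ∀ s ∈ S, 0 < dt p q s → ∃ Q ∈ 𝒬, LE' Q p q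

lemma Good.ps {S : Finset Pt} {T : PlaneGraph S} {M F : Finset (Sym2 Pt)} {𝒬 : Finset (Finset Pt)}
    (h : Good T M F 𝒬) : IsPsFlippable T F := by
  refine ⟨h.FT, 𝒬, fun Q hQ => ⟨by exact_mod_cast h.sub Q hQ, h.card Q hQ, h.cp Q hQ, ?_, ?_⟩, ?_, h.diag⟩
  · intro p q hpq
    rcases hull_edge hpq with h1 | h1
    · exact (h.le Q hQ _ _ h1).1
    · rw [Sym2.eq_swap]; exact (h.le Q hQ _ _ h1).1
  · intro p hp hi
    have := h.card Q hQ
    exact vert_not_int (h.cp Q hQ) (by omega) (h.emp Q hQ p hp (interior_subset hi)) hi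
  · intro Q hQ Q' hQ' hne
    ext z
    simp only [Set.mem_inter_iff, Set.mem_empty_iff_false, iff_false, not_and]
    exact fun h1 h2 => h.disj Q hQ Q' hQ' hne z h1 h2

lemma le_third {S Q : Finset Pt} (hS : GenPos S) (hQ : Q ⊆ S) (hc : 3 ≤ Q.card) {p q : Pt} (h : LE' Q p q) :
    ∃ c ∈ Q, 0 < dt p q c := by
  obtain ⟨hp, hq, hne, hh⟩ := h
  have : ((Q.erase p).erase q).Nonempty := by
    rw [← Finset.card_pos, Finset.card_erase_of_mem, Finset.card_erase_of_mem hp]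
    · omega
    · exact Finset.mem_erase.2 ⟨hne.symm, hq⟩
  obtain ⟨c, hc⟩ := this
  simp only [Finset.mem_erase] at hc
  exact ⟨c, hc.2.2, lt_of_le_of_ne (hh c hc.2.2)
    (Ne.symm (gp_dt hS (hQ hp) (hQ hq) (hQ hc.2.2) hne (Ne.symm hc.2.1) (Ne.symm hc.1)))⟩

lemma le_pos {S Q : Finset Pt} (hS : GenPos S) (hQ : Q ⊆ S) {p q r : Pt} (h : LE' Q p q) (hr : r ∈ Q)
    (h1 : r ≠ p) (h2 : r ≠ q) : 0 < dt p q r :=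
  lt_of_le_of_ne (h.2.2.2 r hr) (Ne.symm (gp_dt hS (hQ h.1) (hQ h.2.1) (hQ hr) h.2.2.1 h1.symm h2.symm))

lemma good_init {S : Finset Pt} (hS : GenPos S) {T : PlaneGraph S} (hT : IsTriangulation T) (M : Finset (Sym2 Pt)) :
    ∃ 𝒬, Good T M ∅ 𝒬 := by
  refine ⟨S.powerset.filter (fun Q => ∃ a b c, Q = {a,b,c} ∧ Face T a b c), ?_⟩
  have hmem : ∀ Q, Q ∈ S.powerset.filter (fun Q => ∃ a b c, Q = {a,b,c} ∧ Face T a b c) →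
      ∃ a b c, Q = {a,b,c} ∧ Face T a b c := fun Q h => (Finset.mem_filter.1 h).2
  have hcoe : ∀ a b c : Pt, ((({a,b,c} : Finset Pt)) : Set Pt) = {a,b,c} := by intro a b c; simp
  constructor
  · simp
  · simp
  · intro Q hQ
    exact Finset.mem_powerset.1 (Finset.mem_filter.1 hQ).1
  · intro Q hQ
    obtain ⟨a, b, c, rfl, hF⟩ := hmem Q hQ
    rw [Finset.card_eq_three.2 ⟨a, b, c, edge_ne T hF.ab, (edge_ne T hF.ca).symm, edge_ne T hF.bc, rfl⟩]
  · intro Q hQ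
    obtain ⟨a, b, c, rfl, hF⟩ := hmem Q hQ
    have key : ∀ p u v : Pt, dt u v p ≠ 0 → ({a,b,c} : Finset Pt) ⊆ {p,u,v} →
        p ∉ convexHull ℝ (↑(({a,b,c} : Finset Pt).erase p) : Set Pt) := by
      intro p u v h hsub hp
      have hs : (↑(({a,b,c} : Finset Pt).erase p) : Set Pt) ⊆ {u,v} := by
        intro x hx
        have hx := Finset.mem_erase.1 (Finset.mem_coe.1 hx)
        have := hsub hx.2
        simp only [Finset.mem_insert, Finset.mem_singleton] at this
        simp only [Set.mem_insert_iff, Set.mem_singleton_iff]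
        tauto
      have := convexHull_mono hs hp
      rw [convexHull_pair] at this
      exact h (oseg_dt this)
    have h1 := hF.pos
    have r1 := dt_rot a b c
    have r2 := dt_rot b c a
    intro p hp
    simp only [Finset.mem_insert, Finset.mem_singleton] at hp
    rcases hp with rfl | rfl | rfl
    · exact key p b c (by linarith) (by intro x; simp)
    · exact key p c a (by linarith) (by intro x; simp; tauto)
    · exact key p a b (by linarith) (by intro x; simp; tauto)
  · intro Q hQ p q h
    refine ⟨?_, by simp⟩
    obtain ⟨a, b, c, rfl, hF⟩ := hmem Q hQ
    obtain ⟨hp, hq, hne, _⟩ := h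
    have h1 := hF.ab
    have h2 := hF.bc
    have h3 := hF.ca
    have h1' := h1
    have h2' := h2
    have h3' := h3
    rw [Sym2.eq_swap] at h1' h2' h3'
    simp only [Finset.mem_insert, Finset.mem_singleton] at hp hq
    rcases hp with rfl | rfl | rfl <;> rcases hq with rfl | rfl | rfl <;> first | contradiction | assumption
  · intro Q hQ t ht htc
    obtain ⟨a, b, c, rfl, hF⟩ := hmem Q hQ
    rw [hcoe] at htc
    simpa using hF.emp t ht htc
  · intro Q hQ Q' hQ' hne z hz hz'
    obtain ⟨a, b, c, rfl, hF⟩ := hmem Q hQ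
    obtain ⟨a', b', c', rfl, hF'⟩ := hmem Q' hQ'
    rw [hcoe] at hz hz'
    by_cases h : ∀ v ∈ ({a',b',c'} : Finset Pt), v ∈ ({a,b,c} : Finset Pt)
    · apply hne
      symm
      apply Finset.eq_of_subset_of_card_le h
      rw [Finset.card_eq_three.2 ⟨a, b, c, edge_ne T hF.ab, (edge_ne T hF.ca).symm, edge_ne T hF.bc, rfl⟩,
        Finset.card_eq_three.2 ⟨a', b', c', edge_ne T hF'.ab, (edge_ne T hF'.ca).symm, edge_ne T hF'.bc, rfl⟩]
    · push Not at h
      obtain ⟨v, hv, hv'⟩ := h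
      exact face_disj1 hF hF' (by simpa using hv) (by simpa using hv') hz hz'
  · simp
  · intro e he _ Q hQ z hz hzi
    obtain ⟨a, b, c, rfl, hF⟩ := hmem Q hQ
    rw [hcoe] at hzi
    exact face_avoid hF he hz hzi
  · intro p q hpq _ s hs h
    obtain ⟨r, hr, hF⟩ := face_of hS hT hpq hs h
    refine ⟨{p,q,r}, Finset.mem_filter.2 ⟨?_, p, q, r, rfl, hF⟩, by simp, by simp, edge_ne T hpq, ?_⟩
    · rw [Finset.mem_powerset]
      intro x hx
      simp only [Finset.mem_insert, Finset.mem_singleton] at hx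
      rcases hx with rfl | rfl | rfl
      · exact edge_l T hpq
      · exact edge_r T hpq
      · exact hr
    · intro x hx
      simp only [Finset.mem_insert, Finset.mem_singleton] at hx
      rcases hx with rfl | rfl | rfl
      · rw [dt_self1]
      · rw [dt_self2]
      · exact hF.pos.le

/-- Hull of union of two polygons glued along `pq`. -/
lemma glue_sub {A1 A2 : Set Pt} {p q : Pt} (hpq : p ≠ q) (hp1 : p ∈ A1) (hq1 : q ∈ A1) (hp2 : p ∈ A2)
    (A B A' B' : ℝ)
    (hA : 0 < A*(q.1-p.1)+B*(q.2-p.2)) (hB : 0 < A'*(p.1-q.1)+B'*(p.2-q.2))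
    (hA' : ∀ r ∈ A1 ∪ A2, 0 ≤ A*(r.1-p.1)+B*(r.2-p.2)) (hB' : ∀ r ∈ A1 ∪ A2, 0 ≤ A'*(r.1-q.1)+B'*(r.2-q.2))
    (h1 : ∀ r ∈ A1, 0 ≤ dt p q r) (hq2 : q ∈ A2) (h2 : ∀ r ∈ A2, dt p q r ≤ 0) :
    ∀ z ∈ convexHull ℝ (A1 ∪ A2), z ∈ convexHull ℝ A1 ∨ z ∈ convexHull ℝ A2 := by
  have seg : ∀ w ∈ convexHull ℝ (A1 ∪ A2), dt p q w = 0 → w ∈ segment ℝ p q := by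
    intro w hw h0
    refine seg_of_line hpq h0 A B A' B' hA hB ?_ ?_
    · have := hull_aff A B (-(A*p.1+B*p.2)) (fun r hr => by have := hA' r hr; linarith) w hw
      linarith
    · have := hull_aff A' B' (-(A'*q.1+B'*q.2)) (fun r hr => by have := hB' r hr; linarith) w hw
      linarith
  have s1 : segment ℝ p q ⊆ convexHull ℝ A1 :=
    (convex_convexHull ℝ _).segment_subset (subset_convexHull ℝ _ hp1) (subset_convexHull ℝ _ hq1)
  have s2 : segment ℝ p q ⊆ convexHull ℝ A2 :=
    (convex_convexHull ℝ _).segment_subset (subset_convexHull ℝ _ hp2) (subset_convexHull ℝ _ hq2)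
  intro z hz
  have hz' := hz
  rw [convexHull_union ⟨p, hp1⟩ ⟨p, hp2⟩, mem_convexJoin] at hz'
  obtain ⟨x, hx, y, hy, hzxy⟩ := hz'
  have hx0 := hull_dt h1 x hx
  have hy0 : dt p q y ≤ 0 := by
    have := hull_dt (p := q) (q := p) (fun r hr => by rw [dt_swap]; have := h2 r hr; linarith) y hy
    rw [dt_swap] at this; linarith
  have hxU : x ∈ convexHull ℝ (A1 ∪ A2) := convexHull_mono Set.subset_union_left hx
  have hyU : y ∈ convexHull ℝ (A1 ∪ A2) := convexHull_mono Set.subset_union_right hy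
  rcases hy0.eq_or_lt with h | h
  · left
    exact (convex_convexHull ℝ _).segment_subset hx (s1 (seg y hyU h)) hzxy
  · obtain ⟨w, hw, hw0⟩ := cross_line hx0 h
    have hws := seg w ((convex_convexHull ℝ _).segment_subset hxU hyU hw) hw0
    have : z ∈ segment ℝ x w ∪ segment ℝ w y := by
      obtain ⟨t, t0, t1, k1, k2⟩ := mem_seg.1 hzxy
      obtain ⟨r, r0, r1, m1, m2⟩ := mem_seg.1 hw
      rcases le_total t r with htr | htr
      · left
        rcases r0.eq_or_lt with rfl | hr
        · have : t = 0 := by linarith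
          subst this
          exact mem_seg.2 ⟨0, by simp, by simp, by rw [k1]; ring, by rw [k2]; ring⟩
        · refine mem_seg.2 ⟨t/r, by positivity, by rw [div_le_one hr]; exact htr, ?_, ?_⟩
          · rw [k1, m1]; field_simp; ring
          · rw [k2, m2]; field_simp; ring
      · right
        rcases r1.eq_or_lt with rfl | hr
        · have : t = 1 := by linarith
          subst this
          exact mem_seg.2 ⟨1, by simp, by simp, by rw [k1]; ring, by rw [k2]; ring⟩
        · have hr' : 0 < 1 - r := by linarith
          refine mem_seg.2 ⟨(t-r)/(1-r), div_nonneg (by linarith) hr'.le, by rw [div_le_one hr']; linarith, ?_, ?_⟩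
          · rw [k1, m1]; field_simp; ring
          · rw [k2, m2]; field_simp; ring
    rcases this with h | h
    · exact Or.inl ((convex_convexHull ℝ _).segment_subset hx (s1 hws) h)
    · exact Or.inr ((convex_convexHull ℝ _).segment_subset (s2 hws) hy h)

structure Glue (S Q1 Q2 : Finset Pt) (p q : Pt) : Prop where
  sub1 : Q1 ⊆ S
  sub2 : Q2 ⊆ S
  c1 : 3 ≤ Q1.card
  c2 : 3 ≤ Q2.card
  cp1 : InConvexPosition Q1
  cp2 : InConvexPosition Q2
  l1 : LE' Q1 p q
  l2 : LE' Q2 q p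
  np : p ∉ convexHull ℝ (↑((Q1 ∪ Q2).erase p) : Set Pt)
  nq : q ∉ convexHull ℝ (↑((Q1 ∪ Q2).erase q) : Set Pt)

lemma Glue.symm {S Q1 Q2 : Finset Pt} {p q : Pt} (g : Glue S Q1 Q2 p q) : Glue S Q2 Q1 q p :=
  ⟨g.sub2, g.sub1, g.c2, g.c1, g.cp2, g.cp1, g.l2, g.l1, by rw [Finset.union_comm]; exact g.nq,
    by rw [Finset.union_comm]; exact g.np⟩

lemma Glue.neg2 {S Q1 Q2 : Finset Pt} {p q : Pt} (g : Glue S Q1 Q2 p q) : ∀ r ∈ Q2, dt p q r ≤ 0 := by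
  intro r hr
  have := g.l2.2.2.2 r hr
  rw [dt_swap] at this; linarith

lemma Glue.fun {S Q1 Q2 : Finset Pt} {p q : Pt} (g : Glue S Q1 Q2 p q) :
    ∃ A B A' B' : ℝ, 0 < A*(q.1-p.1)+B*(q.2-p.2) ∧ 0 < A'*(p.1-q.1)+B'*(p.2-q.2) ∧
    (∀ r ∈ (Q1 ∪ Q2), 0 ≤ A*(r.1-p.1)+B*(r.2-p.2)) ∧ (∀ r ∈ Q1 ∪ Q2, 0 ≤ A'*(r.1-q.1)+B'*(r.2-q.2)) := by
  obtain ⟨A, B, h⟩ := sep g.np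
  obtain ⟨A', B', h'⟩ := sep g.nq
  have hne := g.l1.2.2.1
  refine ⟨A, B, A', B', h q (Finset.mem_erase.2 ⟨hne.symm, Finset.mem_union_left _ g.l1.2.1⟩),
    h' p (Finset.mem_erase.2 ⟨hne, Finset.mem_union_left _ g.l1.1⟩), ?_, ?_⟩
  · intro r hr
    by_cases hrp : r = p
    · subst hrp; simp
    · exact (h r (Finset.mem_erase.2 ⟨hrp, hr⟩)).le
  · intro r hr
    by_cases hrp : r = q
    · subst hrp; simp
    · exact (h' r (Finset.mem_erase.2 ⟨hrp, hr⟩)).le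

lemma Glue.split {S Q1 Q2 : Finset Pt} {p q : Pt} (g : Glue S Q1 Q2 p q) {A1 A2 : Finset Pt}
    (h1 : A1 ⊆ Q1) (h2 : A2 ⊆ Q2) (hp1 : p ∈ A1) (hq1 : q ∈ A1) (hp2 : p ∈ A2) (hq2 : q ∈ A2) :
    ∀ z ∈ convexHull ℝ (↑(A1 ∪ A2) : Set Pt), z ∈ convexHull ℝ (A1 : Set Pt) ∨ z ∈ convexHull ℝ (A2 : Set Pt) := by
  obtain ⟨A, B, A', B', k1, k2, k3, k4⟩ := g.fun
  intro z hz
  rw [Finset.coe_union] at hz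
  refine glue_sub g.l1.2.2.1 hp1 hq1 hp2 A B A' B' k1 k2 ?_ ?_ ?_ hq2 ?_ z hz
  · rw [← Finset.coe_union]
    exact fun r hr => k3 r (Finset.union_subset_union h1 h2 hr)
  · rw [← Finset.coe_union]
    exact fun r hr => k4 r (Finset.union_subset_union h1 h2 hr)
  · exact fun r hr => g.l1.2.2.2 r (h1 hr)
  · exact fun r hr => g.neg2 r (h2 hr)

lemma Glue.seg {S Q1 Q2 : Finset Pt} {p q : Pt} (g : Glue S Q1 Q2 p q) {w : Pt}
    (hw : w ∈ convexHull ℝ (↑(Q1 ∪ Q2) : Set Pt)) (h0 : dt p q w = 0) : w ∈ segment ℝ p q := by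
  obtain ⟨A, B, A', B', hA, hB, hA', hB'⟩ := g.fun
  refine seg_of_line g.l1.2.2.1 h0 A B A' B' hA hB ?_ ?_
  · have := hull_aff A B (-(A*p.1+B*p.2)) (fun r hr => by have := hA' r hr; linarith) w hw
    linarith
  · have := hull_aff A' B' (-(A'*q.1+B'*q.2)) (fun r hr => by have := hB' r hr; linarith) w hw
    linarith

lemma Glue.half {S Q1 Q2 : Finset Pt} (hS : GenPos S) {p q : Pt} (g : Glue S Q1 Q2 p q) {r : Pt} (hr : r ∈ Q1) :
    r ∉ convexHull ℝ (↑((Q1 ∪ Q2).erase r) : Set Pt) := by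
  by_cases hrp : r = p
  · rw [hrp]; exact g.np
  by_cases hrq : r = q
  · rw [hrq]; exact g.nq
  have hpos := le_pos hS g.sub1 g.l1 hr hrp hrq
  have hr2 : r ∉ Q2 := fun h => by have := g.neg2 r h; linarith
  intro hc
  have e : (Q1 ∪ Q2).erase r = Q1.erase r ∪ Q2 := by
    rw [Finset.erase_union_distrib, Finset.erase_eq_of_notMem hr2]
  rw [e] at hc
  rcases g.split (Finset.erase_subset _ _) (Finset.Subset.refl Q2) (Finset.mem_erase.2 ⟨Ne.symm hrp, g.l1.1⟩)
    (Finset.mem_erase.2 ⟨Ne.symm hrq, g.l1.2.1⟩) g.l2.2.1 g.l2.1 r hc with h | h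
  · exact g.cp1 r hr h
  · have := hull_dt (p := q) (q := p) (fun r hr => g.l2.2.2.2 r hr) r h
    rw [dt_swap] at this; linarith

lemma Glue.cp {S Q1 Q2 : Finset Pt} (hS : GenPos S) {p q : Pt} (g : Glue S Q1 Q2 p q) :
    InConvexPosition (Q1 ∪ Q2) := by
  intro r hr
  rcases Finset.mem_union.1 hr with h | h
  · exact g.half hS h
  · rw [Finset.union_comm]; exact g.symm.half hS h

lemma Glue.diag {S Q1 Q2 : Finset Pt} (hS : GenPos S) {p q : Pt} (g : Glue S Q1 Q2 p q) :
    openSegment ℝ p q ⊆ interior (convexHull ℝ (↑(Q1 ∪ Q2) : Set Pt)) := by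
  obtain ⟨c, hc, h1⟩ := le_third hS g.sub1 g.c1 g.l1
  obtain ⟨d, hd, h2⟩ := le_third hS g.sub2 g.c2 g.l2
  rw [dt_swap] at h2
  exact diag_int (convex_convexHull ℝ _) (subset_convexHull ℝ _ (Finset.mem_union_left _ g.l1.1))
    (subset_convexHull ℝ _ (Finset.mem_union_left _ g.l1.2.1)) (subset_convexHull ℝ _ (Finset.mem_union_left _ hc))
    (subset_convexHull ℝ _ (Finset.mem_union_right _ hd)) h1 (by linarith)

lemma Glue.int_half {S Q1 Q2 : Finset Pt} {p q : Pt} (g : Glue S Q1 Q2 p q) {z : Pt}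
    (hz : z ∈ interior (convexHull ℝ (↑(Q1 ∪ Q2) : Set Pt))) (h : 0 < dt p q z) :
    z ∈ interior (convexHull ℝ (Q1 : Set Pt)) := by
  rw [mem_interior]
  refine ⟨interior (convexHull ℝ (↑(Q1 ∪ Q2) : Set Pt)) ∩ {z | 0 < dt p q z}, ?_,
    isOpen_interior.inter (isOpen_lt continuous_const (dt_cont _ _)), hz, h⟩
  rintro w ⟨hw, hw0⟩
  rcases g.split (Finset.Subset.refl _) (Finset.Subset.refl _) g.l1.1 g.l1.2.1 g.l2.2.1 g.l2.1 w
    (interior_subset hw) with h | h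
  · exact h
  · have := hull_dt (p := q) (q := p) (fun r hr => g.l2.2.2.2 r hr) w h
    rw [dt_swap] at this
    simp only [Set.mem_ofPred_eq] at hw0
    linarith

lemma Glue.int {S Q1 Q2 : Finset Pt} (hS : GenPos S) {p q : Pt} (g : Glue S Q1 Q2 p q) {z : Pt}
    (hz : z ∈ interior (convexHull ℝ (↑(Q1 ∪ Q2) : Set Pt))) :
    z ∈ interior (convexHull ℝ (Q1 : Set Pt)) ∨ z ∈ interior (convexHull ℝ (Q2 : Set Pt)) ∨ z ∈ openSegment ℝ p q := by
  rcases lt_trichotomy 0 (dt p q z) with h | h | h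
  · exact Or.inl (g.int_half hz h)
  · right; right
    have hc : 2 ≤ (Q1 ∪ Q2).card := by
      have := Finset.card_le_card (Finset.subset_union_left (s₁ := Q1) (s₂ := Q2))
      have := g.c1
      omega
    rcases seg_cases (g.seg (interior_subset hz) h.symm) with rfl | rfl | h
    · exact absurd hz (vert_not_int (g.cp hS) hc (Finset.mem_union_left _ g.l1.1))
    · exact absurd hz (vert_not_int (g.cp hS) hc (Finset.mem_union_left _ g.l1.2.1))
    · exact h
  · right; left
    rw [Finset.union_comm] at hz
    exact g.symm.int_half hz (by rw [dt_swap]; linarith)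

/-- left edges other than `pq` persist -/
lemma Glue.persist {S Q1 Q2 : Finset Pt} (hS : GenPos S) {p q : Pt} (g : Glue S Q1 Q2 p q) {u v : Pt}
    (h : LE' Q1 u v) (hne : s(u,v) ≠ s(p,q)) : LE' (Q1 ∪ Q2) u v := by
  refine ⟨Finset.mem_union_left _ h.1, Finset.mem_union_left _ h.2.1, h.2.2.1, ?_⟩
  intro d hd
  rcases Finset.mem_union.1 hd with hd | hd
  · exact h.2.2.2 d hd
  by_contra hneg
  push Not at hneg
  obtain ⟨c, hc, hpos⟩ := le_third hS g.sub1 g.c1 h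
  have hm := diag_int (convex_convexHull ℝ (↑(Q1 ∪ Q2) : Set Pt)) (subset_convexHull ℝ _ (Finset.mem_union_left _ h.1))
    (subset_convexHull ℝ _ (Finset.mem_union_left _ h.2.1)) (subset_convexHull ℝ _ (Finset.mem_union_left _ hc))
    (subset_convexHull ℝ _ (Finset.mem_union_right _ hd)) hpos hneg (mid_oseg u v)
  have hmpos : 0 < dt p q (mid u v) := by
    have e : dt p q (mid u v) = (dt p q u + dt p q v)/2 := by simp only [mid, dt]; ring
    have hu := g.l1.2.2.2 u h.1
    have hv := g.l1.2.2.2 v h.2.1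
    rw [e]
    by_contra hc
    have hu0 : dt p q u = 0 := by linarith
    have hv0 : dt p q v = 0 := by linarith
    have a := gp_zero hS (g.sub1 g.l1.1) (g.sub1 g.l1.2.1) (g.sub1 h.1) g.l1.2.2.1 hu0
    have b := gp_zero hS (g.sub1 g.l1.1) (g.sub1 g.l1.2.1) (g.sub1 h.2.1) g.l1.2.2.1 hv0
    rcases a with rfl | rfl <;> rcases b with rfl | rfl
    · exact h.2.2.1 rfl
    · exact hne rfl
    · exact hne Sym2.eq_swap
    · exact h.2.2.1 rfl
  have := dt_int h.2.2.1 (hull_dt (Q := (Q1 : Set Pt)) (fun r hr => h.2.2.2 r hr)) (g.int_half hm hmpos)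
  rw [oseg_dt (openSegment_subset_segment ℝ _ _ (mid_oseg u v))] at this
  exact lt_irrefl _ this

lemma Glue.mixed {S Q1 Q2 : Finset Pt} (hS : GenPos S) {p q : Pt} (g : Glue S Q1 Q2 p q) {u v : Pt}
    (hu : u ∈ Q1) (hv : v ∈ Q2) (hup : u ≠ p) (huq : u ≠ q) (hvp : v ≠ p) (hvq : v ≠ q)
    (h : ∀ r ∈ Q1 ∪ Q2, 0 ≤ dt u v r) : False := by
  have h1 := le_pos hS g.sub1 g.l1 hu hup huq
  have h2 := le_pos hS g.sub2 g.l2 hv hvq hvp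
  rw [dt_swap] at h2
  have huv : u ≠ v := by rintro rfl; linarith
  obtain ⟨w, hw, hw0⟩ := cross_line h1.le (by linarith : dt p q v < 0)
  have hws := g.seg ((convex_convexHull ℝ _).segment_subset (subset_convexHull ℝ _ (Finset.mem_union_left _ hu))
    (subset_convexHull ℝ _ (Finset.mem_union_right _ hv)) hw) hw0
  have hS0 := oseg_dt hw
  have hwo : w ∈ openSegment ℝ p q := by
    rcases seg_cases hws with rfl | rfl | h
    · rcases gp_zero hS (g.sub1 hu) (g.sub2 hv) (g.sub1 g.l1.1) huv hS0 with h | h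
      · exact absurd h.symm hup
      · exact absurd h.symm hvp
    · rcases gp_zero hS (g.sub1 hu) (g.sub2 hv) (g.sub1 g.l1.2.1) huv hS0 with h | h
      · exact absurd h.symm huq
      · exact absurd h.symm hvq
    · exact h
  have := dt_int huv (hull_dt (Q := (↑(Q1 ∪ Q2) : Set Pt)) (fun r hr => h r hr)) (g.diag hS hwo)
  linarith

/-- left edges of the union come from one of the pieces and are not `pq` -/
lemma Glue.le_cases {S Q1 Q2 : Finset Pt} (hS : GenPos S) {p q : Pt} (g : Glue S Q1 Q2 p q) {u v : Pt}
    (h : LE' (Q1 ∪ Q2) u v) : (LE' Q1 u v ∨ LE' Q2 u v) ∧ s(u,v) ≠ s(p,q) := by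
  obtain ⟨hu, hv, huv, hh⟩ := h
  have pq1 := g.l1.1
  have pq2 := g.l1.2.1
  have pq3 := g.l2.2.1
  have pq4 := g.l2.1
  constructor
  · have l1 : u ∈ Q1 → v ∈ Q1 → LE' Q1 u v := fun a b => ⟨a, b, huv, fun r hr => hh r (Finset.mem_union_left _ hr)⟩
    have l2 : u ∈ Q2 → v ∈ Q2 → LE' Q2 u v := fun a b => ⟨a, b, huv, fun r hr => hh r (Finset.mem_union_right _ hr)⟩
    have key : ∀ x ∈ Q1 ∪ Q2, (x ∈ Q1 ∧ x ∈ Q2) ∨ (x ∈ Q1 ∧ x ≠ p ∧ x ≠ q) ∨ (x ∈ Q2 ∧ x ≠ p ∧ x ≠ q) := by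
      intro x hx
      by_cases h1 : x = p
      · subst h1; exact Or.inl ⟨pq1, pq3⟩
      by_cases h2 : x = q
      · subst h2; exact Or.inl ⟨pq2, pq4⟩
      rcases Finset.mem_union.1 hx with h | h
      · exact Or.inr (Or.inl ⟨h, h1, h2⟩)
      · exact Or.inr (Or.inr ⟨h, h1, h2⟩)
    rcases key u hu with ⟨a1, a2⟩ | ⟨a1, a2, a3⟩ | ⟨a1, a2, a3⟩ <;>
      rcases key v hv with ⟨b1, b2⟩ | ⟨b1, b2, b3⟩ | ⟨b1, b2, b3⟩
    · exact Or.inl (l1 a1 b1)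
    · exact Or.inl (l1 a1 b1)
    · exact Or.inr (l2 a2 b1)
    · exact Or.inl (l1 a1 b1)
    · exact Or.inl (l1 a1 b1)
    · exact (g.mixed hS a1 b1 a2 a3 b2 b3 hh).elim
    · exact Or.inr (l2 a1 b2)
    · exact (g.symm.mixed hS a1 b1 a3 a2 b3 b2 (by rw [Finset.union_comm]; exact hh)).elim
    · exact Or.inr (l2 a1 b1)
  · intro he
    obtain ⟨c, hc, h1⟩ := le_third hS g.sub1 g.c1 g.l1
    obtain ⟨d, hd, h2⟩ := le_third hS g.sub2 g.c2 g.l2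
    rcases Sym2.eq_iff.1 he with ⟨rfl, rfl⟩ | ⟨rfl, rfl⟩
    · have := hh d (Finset.mem_union_right _ hd)
      rw [dt_swap] at this; linarith
    · have := hh c (Finset.mem_union_left _ hc)
      rw [dt_swap] at this; linarith

lemma good_merge {S : Finset Pt} (hS : GenPos S) {T : PlaneGraph S} {M F : Finset (Sym2 Pt)}
    {𝒬 : Finset (Finset Pt)} (G : Good T M F 𝒬) {p q : Pt} (hpq : s(p,q) ∈ T.edges) (hF : s(p,q) ∉ F)
    (hM : s(p,q) ∉ M) {Q1 Q2 : Finset Pt} (hQ1 : Q1 ∈ 𝒬) (hQ2 : Q2 ∈ 𝒬) (l1 : LE' Q1 p q) (l2 : LE' Q2 q p)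
    (np : p ∉ convexHull ℝ (↑((Q1 ∪ Q2).erase p) : Set Pt)) (nq : q ∉ convexHull ℝ (↑((Q1 ∪ Q2).erase q) : Set Pt)) :
    Good T M (insert s(p,q) F) (insert (Q1 ∪ Q2) ((𝒬.erase Q1).erase Q2)) := by
  have g : Glue S Q1 Q2 p q := ⟨G.sub _ hQ1, G.sub _ hQ2, G.card _ hQ1, G.card _ hQ2, G.cp _ hQ1, G.cp _ hQ2,
    l1, l2, np, nq⟩
  have hmem : ∀ Q ∈ insert (Q1 ∪ Q2) ((𝒬.erase Q1).erase Q2), Q = Q1 ∪ Q2 ∨ (Q ≠ Q1 ∧ Q ≠ Q2 ∧ Q ∈ 𝒬) := by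
    intro Q hQ
    simp only [Finset.mem_insert, Finset.mem_erase] at hQ
    tauto
  have huniq : ∀ Q ∈ 𝒬, ∀ Q' ∈ 𝒬, ∀ u v, LE' Q u v → LE' Q' u v → Q = Q' := by
    intro Q hQ Q' hQ' u v h h'
    by_contra hne
    obtain ⟨c, hc, k⟩ := le_third hS (G.sub _ hQ) (G.card _ hQ) h
    obtain ⟨c', hc', k'⟩ := le_third hS (G.sub _ hQ') (G.card _ hQ') h'
    obtain ⟨z, z1, z2⟩ := same_side (convex_convexHull ℝ (Q : Set Pt)) (convex_convexHull ℝ (Q' : Set Pt))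
      (subset_convexHull ℝ _ h.1) (subset_convexHull ℝ _ h.2.1) (subset_convexHull ℝ _ h'.1)
      (subset_convexHull ℝ _ h'.2.1) (subset_convexHull ℝ _ hc) (subset_convexHull ℝ _ hc') k k'
    exact G.disj Q hQ Q' hQ' hne z z1 z2
  have hav : ∀ Q ∈ 𝒬, ∀ z ∈ openSegment ℝ p q, z ∉ interior (convexHull ℝ (Q : Set Pt)) := by
    intro Q hQ z hz
    exact G.avoid _ hpq hF Q hQ z (openSegment_subset_segment ℝ _ _ hz)
  constructor
  · exact Finset.insert_subset hpq G.FT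
  · intro e he
    rcases Finset.mem_insert.1 he with rfl | h
    · exact hM
    · exact G.FM e h
  · intro Q hQ
    rcases hmem Q hQ with rfl | ⟨_, _, h⟩
    · exact Finset.union_subset g.sub1 g.sub2
    · exact G.sub Q h
  · intro Q hQ
    rcases hmem Q hQ with rfl | ⟨_, _, h⟩
    · have := Finset.card_le_card (Finset.subset_union_left (s₁ := Q1) (s₂ := Q2))
      have := g.c1
      omega
    · exact G.card Q h
  · intro Q hQ
    rcases hmem Q hQ with rfl | ⟨_, _, h⟩
    · exact g.cp hS
    · exact G.cp Q h
  · intro Q hQ u v h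
    have base : s(u,v) ∈ T.edges ∧ s(u,v) ∉ F ∧ s(u,v) ≠ s(p,q) := by
      rcases hmem Q hQ with rfl | ⟨n1, n2, h'⟩
      · obtain ⟨h1 | h1, h2⟩ := g.le_cases hS h
        · exact ⟨(G.le _ hQ1 _ _ h1).1, (G.le _ hQ1 _ _ h1).2, h2⟩
        · exact ⟨(G.le _ hQ2 _ _ h1).1, (G.le _ hQ2 _ _ h1).2, h2⟩
      · refine ⟨(G.le _ h' _ _ h).1, (G.le _ h' _ _ h).2, ?_⟩
        intro he
        rcases Sym2.eq_iff.1 he with ⟨rfl, rfl⟩ | ⟨rfl, rfl⟩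
        · exact n1 (huniq _ h' _ hQ1 _ _ h l1)
        · exact n2 (huniq _ h' _ hQ2 _ _ h l2)
    refine ⟨base.1, ?_⟩
    simp only [Finset.mem_insert, not_or]
    exact ⟨base.2.2, base.2.1⟩
  · intro Q hQ t ht htc
    rcases hmem Q hQ with rfl | ⟨_, _, h⟩
    · rcases g.split (Finset.Subset.refl _) (Finset.Subset.refl _) g.l1.1 g.l1.2.1 g.l2.2.1 g.l2.1 t htc with h | h
      · exact Finset.mem_union_left _ (G.emp _ hQ1 t ht h)
      · exact Finset.mem_union_right _ (G.emp _ hQ2 t ht h)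
    · exact G.emp Q h t ht htc
  · have key : ∀ Q ∈ 𝒬, Q ≠ Q1 → Q ≠ Q2 → ∀ z, z ∈ interior (convexHull ℝ (↑(Q1 ∪ Q2) : Set Pt)) →
        z ∈ interior (convexHull ℝ (Q : Set Pt)) → False := by
      intro Q hQ n1 n2 z hz hz'
      rcases g.int hS hz with h | h | h
      · exact G.disj _ hQ1 _ hQ (Ne.symm n1) z h hz'
      · exact G.disj _ hQ2 _ hQ (Ne.symm n2) z h hz'
      · exact hav Q hQ z h hz'
    intro Q hQ Q' hQ' hne z hz hz'
    rcases hmem Q hQ with rfl | ⟨n1, n2, h⟩ <;> rcases hmem Q' hQ' with rfl | ⟨n1', n2', h'⟩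
    · exact hne rfl
    · exact key Q' h' n1' n2' z hz hz'
    · exact key Q h n1 n2 z hz' hz
    · exact G.disj Q h Q' h' hne z hz hz'
  · intro e he
    rcases Finset.mem_insert.1 he with rfl | he
    · exact ⟨Q1 ∪ Q2, by simp, p, Finset.mem_union_left _ l1.1, q, Finset.mem_union_left _ l1.2.1, rfl, g.diag hS⟩
    · obtain ⟨Q, hQ, a, ha, b, hb, rfl, hd⟩ := G.diag e he
      by_cases h1 : Q = Q1
      · subst h1
        exact ⟨Q ∪ Q2, by simp, a, Finset.mem_union_left _ ha, b, Finset.mem_union_left _ hb, rfl,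
          hd.trans (interior_mono (convexHull_mono (by simp)))⟩
      by_cases h2 : Q = Q2
      · subst h2
        exact ⟨Q1 ∪ Q, by simp, a, Finset.mem_union_right _ ha, b, Finset.mem_union_right _ hb, rfl,
          hd.trans (interior_mono (convexHull_mono (by simp)))⟩
      · exact ⟨Q, by simp [h1, h2, hQ], a, ha, b, hb, rfl, hd⟩
  · intro e he hne Q hQ z hz hzi
    simp only [Finset.mem_insert, not_or] at hne
    rcases hmem Q hQ with rfl | ⟨_, _, h⟩
    · rcases g.int hS hzi with h | h | h
      · exact G.avoid e he hne.2 _ hQ1 z hz h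
      · exact G.avoid e he hne.2 _ hQ2 z hz h
      · have := (T.noncrossing _ hpq _ he (Ne.symm hne.1) z ⟨openSegment_subset_segment ℝ _ _ h, hz⟩).1
        have h3 := oseg_ne l1.2.2.1 h
        rcases Sym2.mem_iff.1 this with h | h
        · exact h3.1 h
        · exact h3.2 h
    · exact G.avoid e he hne.2 Q h z hz hzi
  · intro u v huv hne s hs h
    simp only [Finset.mem_insert, not_or] at hne
    obtain ⟨Q, hQ, hl⟩ := G.dir u v huv hne.2 s hs h
    by_cases h1 : Q = Q1
    · subst h1
      exact ⟨Q ∪ Q2, by simp, g.persist hS hl hne.1⟩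
    by_cases h2 : Q = Q2
    · subst h2
      refine ⟨Q1 ∪ Q, by simp, ?_⟩
      rw [Finset.union_comm]
      exact g.symm.persist hS hl (by rw [Sym2.eq_swap (a := q)]; exact hne.1)
    · exact ⟨Q, by simp [h1, h2, hQ], hl⟩

structure Needed (D : Finset (Sym2 Pt)) (p q a b : Pt) : Prop where
  pq : s(p,q) ∈ D
  pa : s(p,a) ∈ D
  pb : s(p,b) ∈ D
  qa : 0 < dt p q a
  bq : 0 < dt p b q
  ab : 0 < dt p a b
  cone : ∀ x, s(p,x) ∈ D → x ≠ q → 0 ≤ dt p a x ∧ 0 ≤ dt p x b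

lemma wedge_avoid {s : Set Pt} (hs : Convex ℝ s) {p u v x : Pt} (hp : p ∈ s) (hu : u ∈ s) (hv : v ∈ s)
    (h : 0 < dt p u v) (h1 : 0 < dt p u x) (h2 : 0 < dt p x v) :
    ∃ z ∈ segment ℝ p x, z ∈ interior s := by
  have hO : IsOpen {z | 0 < dt u v z} := isOpen_lt continuous_const (dt_cont _ _)
  have hcl : p ∈ closure (openSegment ℝ p x) := segment_subset_closure_openSegment (left_mem_segment _ _ _)
  obtain ⟨z, hz, hzo⟩ := mem_closure_iff.1 hcl _ hO (by simp only [Set.mem_ofPred_eq]; rw [dt_rot p u v]; exact h)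
  refine ⟨z, openSegment_subset_segment ℝ _ _ hzo, ?_⟩
  obtain ⟨t, h0, h1', k1, k2⟩ := mem_oseg.1 hzo
  refine tri_int hs hp hu hv h ?_ hz ?_
  · rw [dt_comb p u p x z t k1 k2, dt_self1]
    have := mul_pos h0 h1
    linarith
  · rw [dt_comb v p p x z t k1 k2, dt_self2, ← dt_rot v p x]
    have := mul_pos h0 h2
    linarith

lemma needed_of {S : Finset Pt} (hS : GenPos S) {T : PlaneGraph S} {M F : Finset (Sym2 Pt)}
    {𝒬 : Finset (Finset Pt)} (G : Good T M F 𝒬) {p q : Pt} (hpq : s(p,q) ∈ T.edges) (hF : s(p,q) ∉ F)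
    {Q1 Q2 : Finset Pt} (hQ1 : Q1 ∈ 𝒬) (hQ2 : Q2 ∈ 𝒬) (l1 : LE' Q1 p q) (l2 : LE' Q2 q p)
    (np : p ∈ convexHull ℝ (↑((Q1 ∪ Q2).erase p) : Set Pt)) : ∃ a b, Needed (T.edges \ F) p q a b := by
  have s1 := G.sub _ hQ1
  have s2 := G.sub _ hQ2
  have hp := s1 l1.1
  have hq := s1 l1.2.1
  have hne := l1.2.2.1
  obtain ⟨c, hc, hc0⟩ := le_third hS s1 (G.card _ hQ1) l1
  obtain ⟨d, hd, hd0⟩ := le_third hS s2 (G.card _ hQ2) l2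
  have hcp : c ≠ p := by rintro rfl; rw [dt_self1] at hc0; exact lt_irrefl _ hc0
  have hdp : d ≠ p := by rintro rfl; rw [dt_self2] at hd0; exact lt_irrefl _ hd0
  have rotd : ∀ r, dt p r q = dt q p r := fun r => dt_rot q p r
  obtain ⟨A, B, hAB⟩ := sep (G.cp _ hQ1 p l1.1)
  obtain ⟨a, ha, hamax⟩ := ang_max (X := Q1.erase p) ⟨q, Finset.mem_erase.2 ⟨hne.symm, l1.2.1⟩⟩ A B hAB
  obtain ⟨A', B', hAB'⟩ := sep (G.cp _ hQ2 p l2.2.1)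
  obtain ⟨b, hb, hbmin⟩ := ang_min (X := Q2.erase p) ⟨q, Finset.mem_erase.2 ⟨hne.symm, l2.1⟩⟩ A' B' hAB'
  obtain ⟨hap, haQ⟩ := Finset.mem_erase.1 ha
  obtain ⟨hbp, hbQ⟩ := Finset.mem_erase.1 hb
  have haq : a ≠ q := by
    rintro rfl
    have := hamax c (Finset.mem_erase.2 ⟨hcp, hc⟩)
    rw [dt_swap'] at this; linarith
  have hbq : b ≠ q := by
    rintro rfl
    have := hbmin d (Finset.mem_erase.2 ⟨hdp, hd⟩)
    rw [dt_swap] at this; linarith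
  have qa := le_pos hS s1 l1 haQ hap haq
  have bq : 0 < dt p b q := by
    rw [rotd]; exact le_pos hS s2 l2 hbQ hbq hbp
  have la : LE' Q1 a p := by
    refine ⟨haQ, l1.1, hap, fun r hr => ?_⟩
    by_cases hrp : r = p
    · rw [hrp, dt_self2]
    · rw [← dt_rot a p r]; exact hamax r (Finset.mem_erase.2 ⟨hrp, hr⟩)
  have lb : LE' Q2 p b := by
    refine ⟨l2.2.1, hbQ, hbp.symm, fun r hr => ?_⟩
    by_cases hrp : r = p
    · rw [hrp, dt_self1]
    · exact hbmin r (Finset.mem_erase.2 ⟨hrp, hr⟩)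
  have hab : a ≠ b := by
    rintro rfl
    rw [dt_swap'] at bq; linarith
  have ab : 0 < dt p a b := by
    by_contra hcon
    push Not at hcon
    have ba : 0 < dt p b a := by
      have := gp_dt hS hp (s2 hbQ) (s1 haQ) hbp.symm hap.symm hab.symm
      rw [dt_swap'] at hcon
      exact lt_of_le_of_ne (by linarith) this.symm
    refine not_hull_of_pos (-(b.2-p.2)+(a.2-p.2)) ((b.1-p.1)-(a.1-p.1)) ?_ np
    intro r hr
    have e : (-(b.2-p.2)+(a.2-p.2))*(r.1-p.1)+((b.1-p.1)-(a.1-p.1))*(r.2-p.2) = dt p b r + dt p r a := by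
      unfold dt; ring
    rw [e]
    obtain ⟨hrp, hrQ⟩ := Finset.mem_erase.1 (Finset.mem_coe.1 hr)
    rcases Finset.mem_union.1 hrQ with h | h
    · have k1 := hamax r (Finset.mem_erase.2 ⟨hrp, h⟩)
      have k2 := l1.2.2.2 r h
      have id := pl p q a b r
      have k3 : 0 ≤ dt p b r := by
        have e : dt p q a * dt p b r = dt p r a * dt p b q + dt p q r * dt p b a := by unfold dt; ring
        have : 0 ≤ dt p q a * dt p b r := by
          rw [e]
          exact add_nonneg (mul_nonneg k1 bq.le) (mul_nonneg k2 ba.le)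
        exact (mul_nonneg_iff_of_pos_left qa).1 this
      by_cases hra : r = a
      · rw [hra, dt_self2]; linarith
      · have := lt_of_le_of_ne k1 (gp_dt hS hp (s1 h) (s1 haQ) (Ne.symm hrp) hap.symm hra).symm
        linarith
    · have k1 := hbmin r (Finset.mem_erase.2 ⟨hrp, h⟩)
      have k2 := l2.2.2.2 r h
      rw [← rotd] at k2
      have k3 : 0 ≤ dt p r a := by
        have e : dt p b q * dt p r a = dt p b r * dt p q a + dt p r q * dt p b a := by unfold dt; ring
        have : 0 ≤ dt p b q * dt p r a := by
          rw [e]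
          exact add_nonneg (mul_nonneg k1 qa.le) (mul_nonneg k2 ba.le)
        exact (mul_nonneg_iff_of_pos_left bq).1 this
      by_cases hrb : r = b
      · rw [hrb, dt_self2]; linarith
      · have := lt_of_le_of_ne k1 (gp_dt hS hp (s2 hbQ) (s2 h) hbp.symm (Ne.symm hrp) (Ne.symm hrb)).symm
        linarith
  have hD : ∀ u v, s(u,v) ∈ T.edges ∧ s(u,v) ∉ F → s(u,v) ∈ T.edges \ F := fun u v h => Finset.mem_sdiff.2 h
  refine ⟨a, b, hD _ _ ⟨hpq, hF⟩, by rw [Sym2.eq_swap]; exact hD _ _ (G.le _ hQ1 _ _ la), hD _ _ (G.le _ hQ2 _ _ lb),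
    qa, bq, ab, ?_⟩
  intro x hx hxq
  obtain ⟨hxT, hxF⟩ := Finset.mem_sdiff.1 hx
  have hxp := edge_ne T hxT
  have w1 : ¬ (0 < dt p q x ∧ 0 < dt p x a) := by
    rintro ⟨h1, h2⟩
    obtain ⟨z, hz, hzi⟩ := wedge_avoid (convex_convexHull ℝ (Q1 : Set Pt)) (subset_convexHull ℝ _ l1.1)
      (subset_convexHull ℝ _ l1.2.1) (subset_convexHull ℝ _ haQ) qa h1 h2
    exact G.avoid _ hxT hxF _ hQ1 z hz hzi
  have w2 : ¬ (0 < dt p b x ∧ 0 < dt p x q) := by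
    rintro ⟨h1, h2⟩
    obtain ⟨z, hz, hzi⟩ := wedge_avoid (convex_convexHull ℝ (Q2 : Set Pt)) (subset_convexHull ℝ _ l2.2.1)
      (subset_convexHull ℝ _ hbQ) (subset_convexHull ℝ _ l2.1) bq h1 h2
    exact G.avoid _ hxT hxF _ hQ2 z hz hzi
  have id : dt p q x * dt p a b + dt p a x * dt p b q + dt p b x * dt p q a = 0 := by unfold dt; ring
  have n0 := gp_dt hS hp hq (edge_r T hxT) hne hxp hxq.symm
  have e1 := dt_swap' p a x
  have e2 := dt_swap' p b x
  have e3 := dt_swap' p q x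
  rcases lt_or_gt_of_ne n0 with h | h
  · have k : 0 ≤ dt p x b := by
      by_contra hc; exact w2 ⟨by linarith, by linarith⟩
    refine ⟨?_, k⟩
    by_contra hc
    push Not at hc
    nlinarith [mul_pos (neg_pos.2 h) ab, mul_pos (neg_pos.2 hc) bq, mul_nonneg k qa.le]
  · have k : 0 ≤ dt p a x := by
      by_contra hc; exact w1 ⟨h, by linarith⟩
    refine ⟨k, ?_⟩
    by_contra hc
    push Not at hc
    nlinarith [mul_pos h ab, mul_nonneg k bq.le, mul_pos (neg_pos.2 hc) qa]

lemma Needed.func {S : Finset Pt} (hS : GenPos S) {T : PlaneGraph S} {D : Finset (Sym2 Pt)} (hD : D ⊆ T.edges)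
    {p q a b : Pt} (h : Needed D p q a b) :
    ∃ A B : ℝ, ∀ x, s(p,x) ∈ D → x ≠ q → 0 < A*(x.1-p.1)+B*(x.2-p.2) := by
  refine ⟨-(a.2-p.2)+(b.2-p.2), (a.1-p.1)-(b.1-p.1), fun x hx hxq => ?_⟩
  have e : (-(a.2-p.2)+(b.2-p.2))*(x.1-p.1)+((a.1-p.1)-(b.1-p.1))*(x.2-p.2) = dt p a x + dt p x b := by
    unfold dt; ring
  rw [e]
  obtain ⟨k1, k2⟩ := h.cone x hx hxq
  by_contra hc
  have z1 : dt p a x = 0 := by linarith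
  have z2 : dt p x b = 0 := by linarith
  have hp := edge_l T (hD hx)
  have hxS := edge_r T (hD hx)
  have hxp := edge_ne T (hD hx)
  have hxa : x = a := (gp_zero hS hp (edge_r T (hD h.pa)) hxS (edge_ne T (hD h.pa)) z1).resolve_left hxp.symm
  rw [hxa] at z2
  have := h.ab
  linarith

lemma needed_core {p q a b m : Pt} (qa : 0 < dt p q a) (bq : 0 < dt p b q)
    (m1 : 0 ≤ dt p a m) (m2 : 0 ≤ dt p m b) {A B A' B' : ℝ}
    (ha : ∀ x, (x = q ∨ x = m ∨ x = b) → 0 < A*(x.1-p.1)+B*(x.2-p.2))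
    (hb : ∀ x, (x = q ∨ x = m ∨ x = a) → 0 < A'*(x.1-p.1)+B'*(x.2-p.2)) : False := by
  rcases le_total 0 (dt p q m) with h | h
  · have e : dt p m b * (A*(q.1-p.1)+B*(q.2-p.2)) + dt p b q * (A*(m.1-p.1)+B*(m.2-p.2)) +
      dt p q m * (A*(b.1-p.1)+B*(b.2-p.2)) = 0 := by unfold dt; ring
    have := mul_nonneg m2 (ha q (by simp)).le
    have := mul_pos bq (ha m (by simp))
    have := mul_nonneg h (ha b (by simp)).le
    linarith
  · have e : dt p a m * (A'*(q.1-p.1)+B'*(q.2-p.2)) + (-dt p q m) * (A'*(a.1-p.1)+B'*(a.2-p.2)) +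
      dt p q a * (A'*(m.1-p.1)+B'*(m.2-p.2)) = 0 := by unfold dt; ring
    have := mul_nonneg m1 (hb q (by simp)).le
    have := mul_nonneg (neg_nonneg.2 h) (hb a (by simp)).le
    have := mul_pos qa (hb m (by simp))
    linarith

lemma needed_two {S : Finset Pt} (hS : GenPos S) {T : PlaneGraph S} {D : Finset (Sym2 Pt)} (hD : D ⊆ T.edges)
    {p q1 q2 q3 m a1 b1 a2 b2 a3 b3 : Pt} (h1 : Needed D p q1 a1 b1) (h2 : Needed D p q2 a2 b2)
    (h3 : Needed D p q3 a3 b3) (n12 : q1 ≠ q2) (n13 : q1 ≠ q3) (n23 : q2 ≠ q3) (hm : s(p,m) ∈ D)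
    (m1 : m ≠ q1) (m2 : m ≠ q2) (m3 : m ≠ q3) : False := by
  obtain ⟨A2, B2, f2⟩ := h2.func hS hD
  obtain ⟨A3, B3, f3⟩ := h3.func hS hD
  have rel : ∀ A B : ℝ, dt p a1 b1 * (A*(q1.1-p.1)+B*(q1.2-p.2)) + dt p b1 q1 * (A*(a1.1-p.1)+B*(a1.2-p.2)) +
      dt p q1 a1 * (A*(b1.1-p.1)+B*(b1.2-p.2)) = 0 := by intro A B; unfold dt; ring
  have c2 : q2 = a1 ∨ q2 = b1 := by
    by_contra hc
    push Not at hc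
    have := rel A2 B2
    have := mul_pos h1.ab (f2 q1 h1.pq n12)
    have := mul_pos h1.bq (f2 a1 h1.pa hc.1.symm)
    have := mul_pos h1.qa (f2 b1 h1.pb hc.2.symm)
    linarith
  have c3 : q3 = a1 ∨ q3 = b1 := by
    by_contra hc
    push Not at hc
    have := rel A3 B3
    have := mul_pos h1.ab (f3 q1 h1.pq n13)
    have := mul_pos h1.bq (f3 a1 h1.pa hc.1.symm)
    have := mul_pos h1.qa (f3 b1 h1.pb hc.2.symm)
    linarith
  obtain ⟨k1, k2⟩ := h1.cone m hm m1
  rcases c2 with e2 | e2 <;> rcases c3 with e3 | e3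
  · exact n23 (e2.trans e3.symm)
  · subst e2 e3
    refine needed_core h1.qa h1.bq k1 k2 (A := A2) (B := B2) (A' := A3) (B' := B3) ?_ ?_
    · rintro x (rfl | rfl | rfl)
      · exact f2 _ h1.pq n12
      · exact f2 _ hm m2
      · exact f2 _ h3.pq n23.symm
    · rintro x (rfl | rfl | rfl)
      · exact f3 _ h1.pq n13
      · exact f3 _ hm m3
      · exact f3 _ h2.pq n23
  · subst e2 e3
    refine needed_core h1.qa h1.bq k1 k2 (A := A3) (B := B3) (A' := A2) (B' := B2) ?_ ?_
    · rintro x (rfl | rfl | rfl)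
      · exact f3 _ h1.pq n13
      · exact f3 _ hm m3
      · exact f3 _ h2.pq n23
    · rintro x (rfl | rfl | rfl)
      · exact f2 _ h1.pq n12
      · exact f2 _ hm m2
      · exact f2 _ h3.pq n23.symm
  · exact n23 (e2.trans e3.symm)

lemma needed_inner {S : Finset Pt} (hS : GenPos S) {T : PlaneGraph S} {D : Finset (Sym2 Pt)} (hD : D ⊆ T.edges)
    {p q a b h : Pt} (hn : Needed D p q a b) (hph : s(p,h) ∈ T.edges) (hh : ∀ t ∈ S, dt p h t ≤ 0) : False := by
  have rel : dt p a b * dt p h q + dt p b q * dt p h a + dt p q a * dt p h b = 0 := by unfold dt; ring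
  have k1 := hh q (edge_r T (hD hn.pq))
  have k2 := hh a (edge_r T (hD hn.pa))
  have k3 := hh b (edge_r T (hD hn.pb))
  have z1 : dt p h q = 0 := by
    by_contra hc
    have : dt p h q < 0 := lt_of_le_of_ne k1 hc
    nlinarith [mul_pos hn.ab (neg_pos.2 this), mul_nonneg hn.bq.le (neg_nonneg.2 k2), mul_nonneg hn.qa.le (neg_nonneg.2 k3)]
  have z2 : dt p h a = 0 := by
    by_contra hc
    have : dt p h a < 0 := lt_of_le_of_ne k2 hc
    nlinarith [mul_nonneg hn.ab.le (neg_nonneg.2 k1), mul_pos hn.bq (neg_pos.2 this), mul_nonneg hn.qa.le (neg_nonneg.2 k3)]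
  have hp := edge_l T hph
  have e1 := (gp_zero hS hp (edge_r T hph) (edge_r T (hD hn.pq)) (edge_ne T hph) z1).resolve_left
    (edge_ne T (hD hn.pq)).symm
  have e2 := (gp_zero hS hp (edge_r T hph) (edge_r T (hD hn.pa)) (edge_ne T hph) z2).resolve_left
    (edge_ne T (hD hn.pa)).symm
  have := hn.qa
  rw [e1, e2, dt_self2] at this
  exact lt_irrefl _ this

lemma Face.rot {S : Finset Pt} {T : PlaneGraph S} {a b c : Pt} (h : Face T a b c) : Face T b c a := by
  refine ⟨by rw [dt_rot a b c]; exact h.pos, h.bc, h.ca, h.ab, ?_⟩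
  intro t ht htc
  have e : ({b,c,a} : Set Pt) = {a,b,c} := by ext x; simp; tauto
  rw [e] at htc
  have := h.emp t ht htc
  tauto

lemma face_unique {S : Finset Pt} {T : PlaneGraph S} {p q r r' : Pt} (h : Face T p q r) (h' : Face T p q r') :
    r = r' := by
  by_contra hne
  have mem : ∀ a b c x : Pt, (x = a ∨ x = b ∨ x = c) → x ∈ convexHull ℝ ({a,b,c} : Set Pt) :=
    fun a b c x hx => subset_convexHull ℝ _ (by simpa using hx)
  obtain ⟨z, z1, z2⟩ := same_side (convex_convexHull ℝ ({p,q,r} : Set Pt)) (convex_convexHull ℝ ({p,q,r'} : Set Pt))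
    (mem p q r p (by simp)) (mem p q r q (by simp)) (mem p q r' p (by simp)) (mem p q r' q (by simp))
    (mem p q r r (by simp)) (mem p q r' r' (by simp)) h.pos h'.pos
  refine face_disj1 h' h (v := r) (by simp) ?_ z2 z1
  have := edge_ne T h.ca
  have := edge_ne T h.bc
  rintro (h | h | h)
  · contradiction
  · exact this h.symm
  · contradiction

lemma exists_generic (S : Finset Pt) : ∃ t : ℝ, ∀ u ∈ S, ∀ v ∈ S, u.1 + t*u.2 = v.1 + t*v.2 → u = v := by
  obtain ⟨t, ht⟩ := Infinite.exists_notMem_finset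
    ((S ×ˢ S).image (fun x : Pt × Pt => -(x.1.1-x.2.1)/(x.1.2-x.2.2)))
  refine ⟨t, fun u hu v hv h => ?_⟩
  by_contra hne
  by_cases h2 : u.2 = v.2
  · rw [h2] at h
    exact hne (Prod.ext (by linarith) h2)
  · apply ht
    refine Finset.mem_image.2 ⟨(u,v), Finset.mem_product.2 ⟨hu, hv⟩, ?_⟩
    have : u.2 - v.2 ≠ 0 := sub_ne_zero.2 h2
    simp only
    rw [div_eq_iff this]; linarith

def DE {S : Finset Pt} (T : PlaneGraph S) : Finset (Pt × Pt) := (S ×ˢ S).filter (fun x => s(x.1,x.2) ∈ T.edges)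
def HE {S : Finset Pt} (T : PlaneGraph S) : Finset (Pt × Pt) :=
  (DE T).filter (fun x => ∀ t ∈ S, dt x.1 x.2 t ≤ 0)

lemma mem_DE {S : Finset Pt} {T : PlaneGraph S} {p q : Pt} : (p,q) ∈ DE T ↔ s(p,q) ∈ T.edges := by
  simp only [DE, Finset.mem_filter, Finset.mem_product]
  exact ⟨fun h => h.2, fun h => ⟨⟨edge_l T h, edge_r T h⟩, h⟩⟩

lemma card_DE {S : Finset Pt} (T : PlaneGraph S) : (DE T).card ≤ 2 * T.edges.card := by
  refine Finset.card_le_mul_card_image_of_maps_to (f := fun x : Pt × Pt => s(x.1,x.2)) ?_ 2 ?_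
  · rintro ⟨p, q⟩ h; exact mem_DE.1 h
  · intro e he
    induction e using Sym2.ind with
    | _ u v =>
    have : (DE T).filter (fun x => s(x.1,x.2) = s(u,v)) ⊆ {(u,v),(v,u)} := by
      rintro ⟨x, y⟩ h
      have := (Finset.mem_filter.1 h).2
      simp only [Finset.mem_insert, Finset.mem_singleton, Prod.mk.injEq]
      exact Sym2.eq_iff.1 this
    exact (Finset.card_le_card this).trans Finset.card_le_two

lemma edges_lower {S : Finset Pt} (hS : GenPos S) {T : PlaneGraph S} (hT : IsTriangulation T) (hne : S.Nonempty) :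
    3 * S.card ≤ T.edges.card + 3 + (HE T).card := by
  obtain ⟨t, hginj⟩ := exists_generic S
  set g : Pt → ℝ := fun u => u.1 + t*u.2 with hg
  have hex : ∀ x : Pt × Pt, ∃ r, x ∈ DE T \ HE T → Face T x.1 x.2 r := by
    rintro ⟨p, q⟩
    by_cases h : (p,q) ∈ DE T \ HE T
    · obtain ⟨h1, h2⟩ := Finset.mem_sdiff.1 h
      simp only [HE, Finset.mem_filter, not_and, not_forall] at h2
      obtain ⟨s, hs, h3⟩ := h2 h1
      obtain ⟨r, _, hr⟩ := face_of hS hT (mem_DE.1 h1) hs (not_le.1 h3)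
      exact ⟨r, fun _ => hr⟩
    · exact ⟨p, fun h' => absurd h' h⟩
  choose ap hap using hex
  have hin : ∀ p q r, Face T p q r → (p,q) ∈ DE T \ HE T := by
    intro p q r h
    rw [Finset.mem_sdiff, mem_DE]
    refine ⟨h.ab, fun h' => ?_⟩
    have := (Finset.mem_filter.1 h').2 r (edge_r T h.bc)
    have := h.pos
    simp only at *
    linarith
  have hap' : ∀ p q r, Face T p q r → ap (p,q) = r := by
    intro p q r h
    exact face_unique (hap (p,q) (hin p q r h)) h
  have hrot : ∀ p q, (p,q) ∈ DE T \ HE T → Face T p q (ap (p,q)) := fun p q h => hap (p,q) h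
  set N := DE T \ HE T with hN
  set A0 := N.filter (fun x => g (ap x) < g x.1 ∧ g (ap x) < g x.2) with hA0
  set A1 := N.filter (fun x => g x.1 < g x.2 ∧ g x.1 < g (ap x)) with hA1
  set A2 := N.filter (fun x => g x.2 < g x.1 ∧ g x.2 < g (ap x)) with hA2
  have c1 : A0.card ≤ A1.card := by
    refine Finset.card_le_card_of_injOn (fun x => (ap x, x.1)) ?_ ?_
    · rintro ⟨p, q⟩ hx
      obtain ⟨h1, h2, h3⟩ := Finset.mem_filter.1 (Finset.mem_coe.1 hx)
      have hF := (hrot p q h1).rot.rot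
      refine Finset.mem_coe.2 (Finset.mem_filter.2 ⟨hin _ _ _ hF, ?_⟩)
      simp only [hap' _ _ _ hF]
      exact ⟨h2, h3⟩
    · rintro ⟨p, q⟩ hx ⟨p', q'⟩ hx' he
      have h1 := (Finset.mem_filter.1 (Finset.mem_coe.1 hx)).1
      have h1' := (Finset.mem_filter.1 (Finset.mem_coe.1 hx')).1
      have hF := (hrot p q h1).rot.rot
      have hF' := (hrot p' q' h1').rot.rot
      simp only [Prod.mk.injEq] at he
      obtain ⟨e1, rfl⟩ := he
      rw [e1] at hF
      rw [face_unique hF hF']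
  have c2 : A0.card ≤ A2.card := by
    refine Finset.card_le_card_of_injOn (fun x => (x.2, ap x)) ?_ ?_
    · rintro ⟨p, q⟩ hx
      obtain ⟨h1, h2, h3⟩ := Finset.mem_filter.1 (Finset.mem_coe.1 hx)
      have hF := (hrot p q h1).rot
      refine Finset.mem_coe.2 (Finset.mem_filter.2 ⟨hin _ _ _ hF, ?_⟩)
      simp only [hap' _ _ _ hF]
      exact ⟨h3, h2⟩
    · rintro ⟨p, q⟩ hx ⟨p', q'⟩ hx' he
      have h1 := (Finset.mem_filter.1 (Finset.mem_coe.1 hx)).1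
      have h1' := (Finset.mem_filter.1 (Finset.mem_coe.1 hx')).1
      have hF := (hrot p q h1).rot
      have hF' := (hrot p' q' h1').rot
      simp only [Prod.mk.injEq] at he
      obtain ⟨rfl, e1⟩ := he
      rw [e1] at hF
      rw [face_unique hF hF']
  have c3 : A0.card + A1.card + A2.card ≤ N.card := by
    have d1 : Disjoint A0 A1 := by
      rw [Finset.disjoint_left]
      intro x h h'
      have := (Finset.mem_filter.1 h).2.1
      have := (Finset.mem_filter.1 h').2.2
      linarith
    have d2 : Disjoint (A0 ∪ A1) A2 := by
      rw [Finset.disjoint_left]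
      intro x h h'
      have k := (Finset.mem_filter.1 h').2
      rcases Finset.mem_union.1 h with h | h
      · have := (Finset.mem_filter.1 h).2.2
        linarith
      · have := (Finset.mem_filter.1 h).2.1
        linarith
    rw [← Finset.card_union_of_disjoint d1, ← Finset.card_union_of_disjoint d2]
    apply Finset.card_le_card
    exact Finset.union_subset (Finset.union_subset (Finset.filter_subset _ _) (Finset.filter_subset _ _)) (Finset.filter_subset _ _)
  have c4 : N.card + (HE T).card = (DE T).card := by
    rw [hN]
    exact Finset.card_sdiff_add_card_eq_card (Finset.filter_subset _ _)
  have hdec : ∀ p q, s(p,q) ∈ T.edges → (∀ r, Face T p q r → g r < g p ∧ g r < g q) → (p,q) ∈ A0 ∪ HE T := by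
    intro p q h hr
    by_cases hH : (p,q) ∈ HE T
    · exact Finset.mem_union_right _ hH
    · have hm : (p,q) ∈ N := Finset.mem_sdiff.2 ⟨mem_DE.2 h, hH⟩
      exact Finset.mem_union_left _ (Finset.mem_filter.2 ⟨hm, hr _ (hrot p q hm)⟩)
  obtain ⟨w, hw, hwmax⟩ := Finset.exists_max_image S g hne
  have glin : ∀ p x : Pt, 1*(x.1-p.1)+t*(x.2-p.2) = g x - g p := by intro p x; simp only [hg]; ring
  have hup : ∀ v ∈ S.erase w, (∃ q, g v < g q ∧ (v,q) ∈ A0 ∪ HE T) ∧ (∃ q, g v < g q ∧ (q,v) ∈ A0 ∪ HE T) := by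
    intro v hv
    obtain ⟨hvw, hvS⟩ := Finset.mem_erase.1 hv
    have hlt : g v < g w := lt_of_le_of_ne (hwmax v hvS) (fun h => hvw (hginj v hvS w hw h))
    obtain ⟨n, hn, hnT, hng⟩ := halfplane hS hT 1 t hvS hw (by rw [glin]; linarith)
    set X := S.filter (fun x => s(v,x) ∈ T.edges ∧ g v < g x) with hX
    have hXn : X.Nonempty := ⟨n, Finset.mem_filter.2 ⟨hn, hnT, by rw [glin] at hng; linarith⟩⟩
    have hXp : ∀ r ∈ X, 0 < 1*(r.1-v.1)+t*(r.2-v.2) := by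
      intro r hr
      have := (Finset.mem_filter.1 hr).2.2
      rw [glin]; linarith
    constructor
    · obtain ⟨q, hq, hm⟩ := ang_max hXn 1 t hXp
      obtain ⟨hqS, hqT, hqg⟩ := Finset.mem_filter.1 hq
      refine ⟨q, hqg, hdec v q hqT ?_⟩
      intro r hF
      have : ¬ g v < g r := by
        intro h
        have h1 := hm r (Finset.mem_filter.2 ⟨edge_l T hF.ca, by rw [Sym2.eq_swap]; exact hF.ca, h⟩)
        rw [dt_swap'] at h1
        have := hF.pos
        linarith
      have hne : g r ≠ g v := fun h => edge_ne T hF.ca (hginj r (edge_l T hF.ca) v hvS h)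
      have : g r < g v := lt_of_le_of_ne (not_lt.1 this) hne
      exact ⟨this, by linarith⟩
    · obtain ⟨q, hq, hm⟩ := ang_min hXn 1 t hXp
      obtain ⟨hqS, hqT, hqg⟩ := Finset.mem_filter.1 hq
      refine ⟨q, hqg, hdec q v (by rw [Sym2.eq_swap]; exact hqT) ?_⟩
      intro r hF
      have : ¬ g v < g r := by
        intro h
        have h1 := hm r (Finset.mem_filter.2 ⟨edge_r T hF.bc, hF.bc, h⟩)
        rw [dt_swap] at h1
        have := hF.pos
        linarith
      have hne : g r ≠ g v := fun h => edge_ne T hF.bc (hginj r (edge_r T hF.bc) v hvS h).symm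
      have : g r < g v := lt_of_le_of_ne (not_lt.1 this) hne
      exact ⟨by linarith, this⟩
  have c5 : 2 * (S.erase w).card ≤ (A0 ∪ HE T).card := by
    have hU : (S.erase w).card ≤ ((A0 ∪ HE T).filter (fun x => g x.1 < g x.2)).card := by
      have : S.erase w ⊆ ((A0 ∪ HE T).filter (fun x => g x.1 < g x.2)).image Prod.fst := by
        intro v hv
        obtain ⟨q, h1, h2⟩ := (hup v hv).1
        exact Finset.mem_image.2 ⟨(v,q), Finset.mem_filter.2 ⟨h2, h1⟩, rfl⟩
      exact (Finset.card_le_card this).trans Finset.card_image_le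
    have hDn : (S.erase w).card ≤ ((A0 ∪ HE T).filter (fun x => ¬ g x.1 < g x.2)).card := by
      have : S.erase w ⊆ ((A0 ∪ HE T).filter (fun x => ¬ g x.1 < g x.2)).image Prod.snd := by
        intro v hv
        obtain ⟨q, h1, h2⟩ := (hup v hv).2
        exact Finset.mem_image.2 ⟨(q,v), Finset.mem_filter.2 ⟨h2, not_lt.2 h1.le⟩, rfl⟩
      exact (Finset.card_le_card this).trans Finset.card_image_le
    have := Finset.card_filter_add_card_filter_not (s := A0 ∪ HE T) (fun x => g x.1 < g x.2)
    omega
  have c6 := Finset.card_union_le A0 (HE T)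
  have c7 := Finset.card_erase_of_mem hw
  have c8 := card_DE T
  have c9 := Finset.card_pos.2 hne
  omega

lemma matching_card {S : Finset Pt} {M : PlaneGraph S} (hM : IsPerfectMatching M) : 2 * M.edges.card ≤ S.card := by
  have hc : ∀ p, ∃ e, p ∈ S → (e ∈ M.edges ∧ p ∈ e) ∧ ∀ e', e' ∈ M.edges ∧ p ∈ e' → e' = e := by
    intro p
    by_cases hp : p ∈ S
    · obtain ⟨e, h1, h2⟩ := hM p hp
      exact ⟨e, fun _ => ⟨h1, h2⟩⟩
    · exact ⟨s(p,p), fun h => absurd h hp⟩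
  choose f hf using hc
  refine Finset.mul_card_image_le_card_of_maps_to (f := f) (fun p hp => (hf p hp).1.1) 2 ?_
  intro e he
  induction e using Sym2.ind with
  | _ u v =>
  have hu := edge_l M he
  have hv := edge_r M he
  have : ({u, v} : Finset Pt) ⊆ S.filter (fun x => f x = s(u,v)) := by
    intro x hx
    simp only [Finset.mem_insert, Finset.mem_singleton] at hx
    rcases hx with rfl | rfl
    · exact Finset.mem_filter.2 ⟨hu, ((hf _ hu).2 _ ⟨he, by simp⟩).symm⟩
    · exact Finset.mem_filter.2 ⟨hv, ((hf _ hv).2 _ ⟨he, by simp⟩).symm⟩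
  have h2 := Finset.card_le_card this
  rwa [Finset.card_pair (edge_ne M he)] at h2

lemma card_src {S : Finset Pt} (hS : GenPos S) (T : PlaneGraph S) :
    ((HE T).image Prod.fst).card = (HE T).card := by
  apply Finset.card_image_of_injOn
  rintro ⟨p, q⟩ h ⟨p', q'⟩ h' heq
  simp only at heq
  subst heq
  have h := Finset.mem_filter.1 (Finset.mem_coe.1 h)
  have h' := Finset.mem_filter.1 (Finset.mem_coe.1 h')
  have e := mem_DE.1 h.1
  have e' := mem_DE.1 h'.1
  have k := h.2 q' (edge_r T e')
  have k' := h'.2 q (edge_r T e)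
  simp only at k k'
  rw [dt_swap'] at k'
  have z : dt p q q' = 0 := by linarith
  rcases gp_zero hS (edge_l T e) (edge_r T e) (edge_r T e') (edge_ne T e) z with r | r
  · exact absurd r.symm (edge_ne T e')
  · rw [r]

lemma main_bound {S : Finset Pt} (hS : GenPos S) {T : PlaneGraph S} (hT : IsTriangulation T)
    {M : PlaneGraph S} (hM : IsPerfectMatching M) (hMT : M.edges ⊆ T.edges) (hne : S.Nonempty) :
    ∃ F 𝒬, Good T M.edges F 𝒬 ∧ S.card ≤ 2 * F.card + 6 := by
  obtain ⟨𝒬0, hQ0⟩ := good_init hS hT M.edges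
  obtain ⟨F, hFm, hmax⟩ := Finset.exists_max_image (T.edges.powerset.filter (fun F => ∃ 𝒬, Good T M.edges F 𝒬))
    Finset.card ⟨∅, Finset.mem_filter.2 ⟨by simp, 𝒬0, hQ0⟩⟩
  obtain ⟨𝒬, G⟩ := (Finset.mem_filter.1 hFm).2
  refine ⟨F, 𝒬, G, ?_⟩
  set D := T.edges \ F with hDdef
  have hD : D ⊆ T.edges := Finset.sdiff_subset
  set Hs := (HE T).image Prod.fst with hHs
  have hHsS : Hs ⊆ S := by
    intro p hp
    obtain ⟨⟨p', q⟩, h, rfl⟩ := Finset.mem_image.1 hp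
    exact edge_l T (mem_DE.1 (Finset.mem_filter.1 h).1)
  have hnotHs : ∀ p q a b, Needed D p q a b → p ∉ Hs := by
    intro p q a b hn hp
    obtain ⟨⟨p', h⟩, hh, rfl⟩ := Finset.mem_image.1 hp
    have hh := Finset.mem_filter.1 hh
    exact needed_inner hS hD hn (mem_DE.1 hh.1) hh.2
  set P := (S ×ˢ S).filter (fun x => x.1 ∉ Hs ∧ s(x.1,x.2) ∉ M.edges ∧ ∃ a b, Needed D x.1 x.2 a b) with hP
  have hPcard : P.card ≤ 2 * (S \ Hs).card := by
    refine Finset.card_le_mul_card_image_of_maps_to (f := Prod.fst) ?_ 2 ?_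
    · rintro ⟨p, q⟩ h
      have h := Finset.mem_filter.1 h
      exact Finset.mem_sdiff.2 ⟨(Finset.mem_product.1 h.1).1, h.2.1⟩
    · intro p hp
      by_contra hc
      push Not at hc
      obtain ⟨x, hx, y, hy, z, hz, xy, xz, yz⟩ := Finset.two_lt_card.1 hc
      obtain ⟨p1, q1⟩ := x
      obtain ⟨p2, q2⟩ := y
      obtain ⟨p3, q3⟩ := z
      obtain ⟨hxP, e1⟩ := Finset.mem_filter.1 hx
      obtain ⟨hyP, e2⟩ := Finset.mem_filter.1 hy
      obtain ⟨hzP, e3⟩ := Finset.mem_filter.1 hz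
      simp only at e1 e2 e3
      subst e1 e2 e3
      obtain ⟨_, _, m1, a1, b1, n1⟩ := Finset.mem_filter.1 hxP
      obtain ⟨_, _, m2, a2, b2, n2⟩ := Finset.mem_filter.1 hyP
      obtain ⟨_, _, m3, a3, b3, n3⟩ := Finset.mem_filter.1 hzP
      obtain ⟨e, ⟨he, hpe⟩, -⟩ := hM _ (Finset.mem_sdiff.1 hp).1
      obtain ⟨m, rfl⟩ := Sym2.mem_iff_exists.1 hpe
      refine needed_two hS hD n1 n2 n3 (fun h => xy (Prod.ext rfl h)) (fun h => xz (Prod.ext rfl h)) (fun h => yz (Prod.ext rfl h))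
        (m := m) (Finset.mem_sdiff.2 ⟨hMT he, fun h => G.FM _ h he⟩) ?_ ?_ ?_
      · rintro rfl; exact m1 he
      · rintro rfl; exact m2 he
      · rintro rfl; exact m3 he
  have hcover : D ⊆ ((HE T).image (fun x => s(x.1,x.2)) ∪ M.edges) ∪ P.image (fun x => s(x.1,x.2)) := by
    intro e he
    obtain ⟨heT, heF⟩ := Finset.mem_sdiff.1 he
    by_contra hc
    simp only [Finset.mem_union, not_or] at hc
    obtain ⟨⟨c1, c2⟩, c3⟩ := hc
    induction e using Sym2.ind with
    | _ p q =>
    have heT' : s(q,p) ∈ T.edges := by rwa [Sym2.eq_swap]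
    have heF' : s(q,p) ∉ F := by rwa [Sym2.eq_swap]
    have k1 : (p,q) ∉ HE T := fun h => c1 (Finset.mem_image.2 ⟨_, h, rfl⟩)
    have k2 : (q,p) ∉ HE T := fun h => c1 (Finset.mem_image.2 ⟨_, h, Sym2.eq_swap⟩)
    have side : ∀ u v, s(u,v) ∈ T.edges → (u,v) ∉ HE T → ∃ t ∈ S, 0 < dt u v t := by
      intro u v h1 h2
      by_contra hc
      push Not at hc
      exact h2 (Finset.mem_filter.2 ⟨mem_DE.2 h1, hc⟩)
    obtain ⟨t1, ht1, d1⟩ := side _ _ heT k1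
    obtain ⟨t2, ht2, d2⟩ := side _ _ heT' k2
    obtain ⟨Q1, hQ1, l1⟩ := G.dir _ _ heT heF t1 ht1 d1
    obtain ⟨Q2, hQ2, l2⟩ := G.dir _ _ heT' heF' t2 ht2 d2
    by_cases np : p ∈ convexHull ℝ (↑((Q1 ∪ Q2).erase p) : Set Pt)
    · obtain ⟨a, b, hn⟩ := needed_of hS G heT heF hQ1 hQ2 l1 l2 np
      exact c3 (Finset.mem_image.2 ⟨(p,q), Finset.mem_filter.2
        ⟨Finset.mem_product.2 ⟨edge_l T heT, edge_r T heT⟩, hnotHs _ _ _ _ hn, c2, a, b, hn⟩, rfl⟩)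
    by_cases nq : q ∈ convexHull ℝ (↑((Q1 ∪ Q2).erase q) : Set Pt)
    · rw [Finset.union_comm] at nq
      obtain ⟨a, b, hn⟩ := needed_of hS G heT' heF' hQ2 hQ1 l2 l1 nq
      refine c3 (Finset.mem_image.2 ⟨(q,p), Finset.mem_filter.2
        ⟨Finset.mem_product.2 ⟨edge_l T heT', edge_r T heT'⟩, hnotHs _ _ _ _ hn, ?_, a, b, hn⟩, Sym2.eq_swap⟩)
      simpa only [Sym2.eq_swap] using c2
    have G' := good_merge hS G heT heF c2 hQ1 hQ2 l1 l2 np nq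
    have := hmax _ (Finset.mem_filter.2 ⟨Finset.mem_powerset.2 G'.FT, _, G'⟩)
    rw [Finset.card_insert_of_notMem heF] at this
    omega
  have i1 := Finset.card_le_card hcover
  have i2 := Finset.card_union_le ((HE T).image (fun x => s(x.1,x.2)) ∪ M.edges) (P.image (fun x => s(x.1,x.2)))
  have i3 := Finset.card_union_le ((HE T).image (fun x => s(x.1,x.2))) M.edges
  have i4 : ((HE T).image (fun x => s(x.1,x.2))).card ≤ _ := Finset.card_image_le
  have i5 : (P.image (fun x => s(x.1,x.2))).card ≤ _ := Finset.card_image_le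
  have i6 := edges_lower hS hT hne
  have i7 := matching_card hM
  have i8 := card_src hS T
  have i9 := Finset.card_sdiff_add_card_eq_card hHsS
  have i10 := Finset.card_sdiff_add_card_eq_card G.FT
  rw [← hHs] at i8
  rw [← hDdef] at i10
  omega

/-- for any perfect matching `M` contained in a triangulation `T`
of an even-size point set, `T` has a set of at least `N/2 - 3` ps-flippable
edges avoiding `M`. -/
theorem statement17 (S : Finset Pt) (hS : GenPos S) (heven : Even S.card)
    (T : PlaneGraph S) (hT : IsTriangulation T)
    (M : PlaneGraph S) (hM : IsPerfectMatching M) (hMT : M.edges ⊆ T.edges) :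
    ∃ F : Finset (Sym2 Pt), IsPsFlippable T F ∧
      (S.card : ℝ) / 2 - 3 ≤ (F.card : ℝ) ∧ ∀ e ∈ F, e ∉ M.edges := by
  rcases S.eq_empty_or_nonempty with h | hne
  · obtain ⟨𝒬, G⟩ := good_init hS hT M.edges
    refine ⟨∅, G.ps, ?_, G.FM⟩
    have : S.card = 0 := by rw [h]; rfl
    rw [this]
    norm_num
  · obtain ⟨F, 𝒬, G, hc⟩ := main_bound hS hT hM hMT hne
    refine ⟨F, G.ps, ?_, G.FM⟩
    have : (S.card : ℝ) ≤ 2 * F.card + 6 := by exact_mod_cast hc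
    linarith

end
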